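/- arXiv:math/0701682 — 3 statements merged into one kernel-verified Lean document; each statement's English description precedes it below -/
import Mathlib

section
/- Let u be the free pluriharmonic function with scalar coefficients (a, b) on the unit ball (γ = 1). Then u is positive (i.e., u_K(X) ≥ 0 for every complex Hilbert space K and every X ∈ [B(K)ⁿ]₁) if and only if for every m ∈ ℕ the operator Σ_{1 ≤ |α| ≤ m} b_α (S_α^(m))* + a_{g₀} I + Σ_{1 ≤ |α| ≤ m} a_α S_α^(m) on P^(m) is a positive operator. -/
open scoped ENNReal ComplexOrder
open Filter ContinuousLinearMap

noncomputable section

abbrev Word (n : ℕ) := FreeMonoid (Fin n)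

/-- The word determined by a tuple of letters. -/
def word {n k : ℕ} (f : Fin k → Fin n) : Word n :=
  FreeMonoid.ofList (List.ofFn f)

/-- The length of a word. -/
def wordLen {n : ℕ} (α : Word n) : ℕ := (FreeMonoid.toList α).length

/-- The product `X_α = X_{i₁} ⋯ X_{i_k}` for `α = g_{i₁} ⋯ g_{i_k}`. -/
def wordProd {n : ℕ} {K : Type} [NormedAddCommGroup K] [InnerProductSpace ℂ K]
    (X : Fin n → K →L[ℂ] K) (α : Word n) : K →L[ℂ] K :=
  ((FreeMonoid.toList α).map X).prod

/-- `Σ_{|α| = k} a_α X_α`. -/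
def truncSum {n : ℕ} {K : Type} [NormedAddCommGroup K] [InnerProductSpace ℂ K]
    (a : Word n → ℂ) (X : Fin n → K →L[ℂ] K) (k : ℕ) : K →L[ℂ] K :=
  ∑ f : Fin k → Fin n, a (word f) • wordProd X (word f)

/-- `Σ_{|α| = k} b_α X_α*`. -/
def truncSumAdj {n : ℕ} {K : Type} [NormedAddCommGroup K] [InnerProductSpace ℂ K]
    [CompleteSpace K] (b : Word n → ℂ) (X : Fin n → K →L[ℂ] K) (k : ℕ) : K →L[ℂ] K :=
  ∑ f : Fin k → Fin n, b (word f) • adjoint (wordProd X (word f))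

/-- The free holomorphic function `f(X) = Σ_k Σ_{|α| = k} a_α X_α`. -/
def holOp {n : ℕ} {K : Type} [NormedAddCommGroup K] [InnerProductSpace ℂ K]
    (a : Word n → ℂ) (X : Fin n → K →L[ℂ] K) : K →L[ℂ] K :=
  ∑' k : ℕ, truncSum a X k

/-- The free pluriharmonic function
`u(X) = Σ_{k ≥ 1} Σ_{|α| = k} b_α X_α* + a_{g₀} I + Σ_{k ≥ 1} Σ_{|α| = k} a_α X_α`. -/
def phOp {n : ℕ} {K : Type} [NormedAddCommGroup K] [InnerProductSpace ℂ K]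
    [CompleteSpace K] (a b : Word n → ℂ) (X : Fin n → K →L[ℂ] K) : K →L[ℂ] K :=
  (∑' k : ℕ, truncSumAdj b X (k + 1)) + a 1 • (1 : K →L[ℂ] K)
    + ∑' k : ℕ, truncSum a X (k + 1)

/-- Membership in the open noncommutative ball of radius `γ`. -/
def inBall {n : ℕ} {K : Type} [NormedAddCommGroup K] [InnerProductSpace ℂ K]
    [CompleteSpace K] (γ : ℝ) (X : Fin n → K →L[ℂ] K) : Prop :=
  ‖∑ i, X i * adjoint (X i)‖ < γ ^ 2

/-- Membership in the closed noncommutative ball of radius `γ`. -/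
def inClosedBall {n : ℕ} {K : Type} [NormedAddCommGroup K] [InnerProductSpace ℂ K]
    [CompleteSpace K] (γ : ℝ) (X : Fin n → K →L[ℂ] K) : Prop :=
  ‖∑ i, X i * adjoint (X i)‖ ≤ γ ^ 2

/-- The radius-`γ` condition `limsup_k (Σ_{|α|=k} |a_α|²)^{1/(2k)} ≤ 1/γ`. -/
def radCond {n : ℕ} (γ : ℝ) (a : Word n → ℂ) : Prop :=
  Filter.limsup
    (fun k : ℕ =>
      (∑ f : Fin k → Fin n, (‖a (word f)‖₊ : ℝ≥0∞) ^ 2) ^ ((1 : ℝ) / (2 * (k : ℝ))))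
    Filter.atTop ≤ ENNReal.ofReal (1 / γ)

/-- The coefficients of the radial function: `α ↦ r^{|α|} a_α`. -/
def scaleCoef {n : ℕ} (r : ℝ) (a : Word n → ℂ) : Word n → ℂ :=
  fun α => ((r : ℂ) ^ wordLen α) * a α

/-- Positivity of the free pluriharmonic function with coefficients `(a, b)` on the
noncommutative ball of radius `γ` of every complex Hilbert space. -/
def posPH {n : ℕ} (γ : ℝ) (a b : Word n → ℂ) : Prop :=
  ∀ (K : Type) [NormedAddCommGroup K] [InnerProductSpace ℂ K] [CompleteSpace K],
    ∀ X : Fin n → K →L[ℂ] K, inBall γ X → (phOp a b X).IsPositive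


lemma wordLen_one {n : ℕ} : wordLen (1 : Word n) = 0 := rfl

lemma wordLen_mul {n : ℕ} (α β : Word n) : wordLen (α * β) = wordLen α + wordLen β := by
  simp [wordLen]

lemma wordLen_of {n : ℕ} (i : Fin n) : wordLen (FreeMonoid.of i) = 1 := rfl

lemma wordLen_word {n k : ℕ} (f : Fin k → Fin n) : wordLen (word f) = k := by
  simp [wordLen, word]

lemma word_inj {n k : ℕ} : Function.Injective (word : (Fin k → Fin n) → Word n) := by
  intro f g h
  exact List.ofFn_injective (FreeMonoid.ofList.injective h)

lemma word_cons {n k : ℕ} (i : Fin n) (f : Fin k → Fin n) :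
    word (Fin.cons i f : Fin (k+1) → Fin n) = FreeMonoid.of i * word f := by
  simp [word, List.ofFn_succ, FreeMonoid.ofList_cons]

lemma exists_word {n : ℕ} (α : Word n) : ∃ f : Fin (wordLen α) → Fin n, word f = α := by
  refine ⟨fun i => (FreeMonoid.toList α).get i, ?_⟩
  simp only [word]
  erw [List.ofFn_get]
  simp

section gen
variable {n : ℕ} {K : Type} [NormedAddCommGroup K] [InnerProductSpace ℂ K]

lemma wordProd_one (X : Fin n → K →L[ℂ] K) : wordProd X 1 = 1 := rfl

lemma wordProd_mul (X : Fin n → K →L[ℂ] K) (α β : Word n) :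
    wordProd X (α * β) = wordProd X α * wordProd X β := by
  simp [wordProd]

lemma wordProd_of (X : Fin n → K →L[ℂ] K) (i : Fin n) : wordProd X (FreeMonoid.of i) = X i := by
  simp [wordProd]

lemma sum_word_succ {M : Type*} [AddCommMonoid M] (k : ℕ) (g : Word n → M) :
    ∑ f : Fin (k+1) → Fin n, g (word f)
      = ∑ i : Fin n, ∑ f : Fin k → Fin n, g (FreeMonoid.of i * word f) := by
  rw [← Fintype.sum_prod_type', ← (Fin.consEquiv (fun _ => Fin n)).sum_comp]
  refine Finset.sum_congr rfl fun x _ => ?_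
  rw [← word_cons]; rfl

lemma sum_word_zero {M : Type*} [AddCommMonoid M] (g : Word n → M) :
    ∑ f : Fin 0 → Fin n, g (word f) = g 1 := by
  simp [word, FreeMonoid.ofList_nil]

variable [CompleteSpace K]

def Gf (X : Fin n → K →L[ℂ] K) (j : ℕ) (x y : K) : ℂ :=
  ∑ f : Fin j → Fin n, inner ℂ (adjoint (wordProd X (word f)) x) (adjoint (wordProd X (word f)) y)

lemma adj_mul (X : Fin n → K →L[ℂ] K) (α β : Word n) (x : K) :
    adjoint (wordProd X (α * β)) x = adjoint (wordProd X β) (adjoint (wordProd X α) x) := by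
  rw [wordProd_mul, ContinuousLinearMap.mul_def, adjoint_comp]; rfl

lemma adj_one (X : Fin n → K →L[ℂ] K) (x : K) : adjoint (wordProd X 1) x = x := by
  rw [wordProd_one, ← star_eq_adjoint, star_one]; rfl

lemma Gf_zero (X : Fin n → K →L[ℂ] K) (x y : K) : Gf X 0 x y = inner ℂ x y := by
  unfold Gf
  rw [sum_word_zero (fun w => inner ℂ (adjoint (wordProd X w) x) (adjoint (wordProd X w) y))]
  rw [adj_one, adj_one]

lemma Gf_succ (X : Fin n → K →L[ℂ] K) (j : ℕ) (x y : K) :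
    Gf X (j+1) x y = ∑ i, Gf X j (adjoint (X i) x) (adjoint (X i) y) := by
  unfold Gf
  rw [sum_word_succ j (fun w => inner ℂ (adjoint (wordProd X w) x) (adjoint (wordProd X w) y))]
  simp only [adj_mul, wordProd_of]

/-- the defect operator -/
def Df (X : Fin n → K →L[ℂ] K) : K →L[ℂ] K := 1 - ∑ i, X i * adjoint (X i)

lemma inner_row (X : Fin n → K →L[ℂ] K) (x y : K) :
    inner ℂ x ((∑ i, X i * adjoint (X i)) y) = ∑ i, inner ℂ (adjoint (X i) x) (adjoint (X i) y) := by
  simp [adjoint_inner_left]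

lemma Gf_defect (X : Fin n → K →L[ℂ] K) (j : ℕ) (x y : K) :
    ∑ f : Fin j → Fin n, inner ℂ (adjoint (wordProd X (word f)) x)
        (Df X (adjoint (wordProd X (word f)) y)) = Gf X j x y - Gf X (j+1) x y := by
  induction j generalizing x y with
  | zero =>
    rw [sum_word_zero (fun w => inner ℂ (adjoint (wordProd X w) x) (Df X (adjoint (wordProd X w) y)))]
    rw [adj_one, adj_one, Gf_succ]
    simp only [Gf_zero]
    rw [← inner_row, Df, sub_apply, inner_sub_right]; rfl
  | succ j ih =>
    rw [sum_word_succ j (fun w => inner ℂ (adjoint (wordProd X w) x) (Df X (adjoint (wordProd X w) y)))]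
    simp only [adj_mul, wordProd_of]
    simp only [ih]
    rw [Finset.sum_sub_distrib, Gf_succ, Gf_succ]

lemma Gf_defect_sum (X : Fin n → K →L[ℂ] K) (N : ℕ) (x y : K) :
    ∑ j ∈ Finset.range N, ∑ f : Fin j → Fin n, inner ℂ (adjoint (wordProd X (word f)) x)
        (Df X (adjoint (wordProd X (word f)) y)) = inner ℂ x y - Gf X N x y := by
  simp only [Gf_defect]
  rw [Finset.sum_range_sub', Gf_zero]

lemma sumsq_le (X : Fin n → K →L[ℂ] K) (j : ℕ) (x : K) :
    ∑ f : Fin j → Fin n, ‖adjoint (wordProd X (word f)) x‖ ^ 2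
      ≤ ‖∑ i, X i * adjoint (X i)‖ ^ j * ‖x‖ ^ 2 := by
  induction j generalizing x with
  | zero =>
    rw [sum_word_zero (fun w => ‖adjoint (wordProd X w) x‖ ^ 2), adj_one]; simp
  | succ j ih =>
    rw [sum_word_succ j (fun w => ‖adjoint (wordProd X w) x‖ ^ 2)]
    simp only [adj_mul, wordProd_of]
    have h1 : ∑ i, ‖adjoint (X i) x‖ ^ 2 ≤ ‖∑ i, X i * adjoint (X i)‖ * ‖x‖ ^ 2 := by
      have := inner_row X x x
      simp only [inner_self_eq_norm_sq_to_K] at this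
      have h2 : ((∑ i, ‖adjoint (X i) x‖ ^ 2 : ℝ) : ℂ)
          = inner ℂ x ((∑ i, X i * adjoint (X i)) x) := by
        rw [this]; push_cast; rfl
      calc ∑ i, ‖adjoint (X i) x‖ ^ 2 = ‖((∑ i, ‖adjoint (X i) x‖ ^ 2 : ℝ) : ℂ)‖ := by
            rw [Complex.norm_real, Real.norm_of_nonneg (Finset.sum_nonneg fun _ _ => by positivity)]
        _ ≤ ‖x‖ * ‖(∑ i, X i * adjoint (X i)) x‖ := by rw [h2]; exact norm_inner_le_norm _ _
        _ ≤ ‖x‖ * (‖∑ i, X i * adjoint (X i)‖ * ‖x‖) := by gcongr; exact le_opNorm _ _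
        _ = _ := by ring
    calc _ ≤ ∑ i, ‖∑ i, X i * adjoint (X i)‖ ^ j * ‖adjoint (X i) x‖ ^ 2 :=
          Finset.sum_le_sum fun i _ => ih _
      _ = ‖∑ i, X i * adjoint (X i)‖ ^ j * ∑ i, ‖adjoint (X i) x‖ ^ 2 := by rw [Finset.mul_sum]
      _ ≤ ‖∑ i, X i * adjoint (X i)‖ ^ j * (‖∑ i, X i * adjoint (X i)‖ * ‖x‖ ^ 2) := by gcongr
      _ = _ := by ring

lemma Gf_le (X : Fin n → K →L[ℂ] K) (j : ℕ) (x y : K) :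
    ‖Gf X j x y‖ ≤ ‖∑ i, X i * adjoint (X i)‖ ^ j * (‖x‖ * ‖y‖) := by
  set r := ‖∑ i, X i * adjoint (X i)‖ with hr
  have hr0 : 0 ≤ r := norm_nonneg _
  calc ‖Gf X j x y‖ ≤ ∑ f : Fin j → Fin n, ‖adjoint (wordProd X (word f)) x‖
        * ‖adjoint (wordProd X (word f)) y‖ :=
        (norm_sum_le _ _).trans (Finset.sum_le_sum fun _ _ => norm_inner_le_norm _ _)
    _ ≤ r ^ j * (‖x‖ * ‖y‖) := by
      refine abs_le_of_sq_le_sq' ?_ (by positivity) |>.2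
      refine (Finset.sum_mul_sq_le_sq_mul_sq _ _ _).trans ?_
      calc _ ≤ (r ^ j * ‖x‖ ^ 2) * (r ^ j * ‖y‖ ^ 2) := by
            gcongr
            · exact sumsq_le X j x
            · exact sumsq_le X j y
        _ = _ := by ring

/-- square root of the sum of squares of coefficients of degree k -/
def sig (a : Word n → ℂ) (k : ℕ) : ℝ := √(∑ f : Fin k → Fin n, ‖a (word f)‖ ^ 2)

lemma row_bound (a : Word n → ℂ) (X : Fin n → K →L[ℂ] K) (k : ℕ) (x : K) :
    ∑ f : Fin k → Fin n, ‖a (word f)‖ * ‖adjoint (wordProd X (word f)) x‖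
      ≤ sig a k * √‖∑ i, X i * adjoint (X i)‖ ^ k * ‖x‖ := by
  set r := ‖∑ i, X i * adjoint (X i)‖ with hr
  have hs : 0 ≤ sig a k := Real.sqrt_nonneg _
  refine abs_le_of_sq_le_sq' ?_ (by positivity) |>.2
  refine (Finset.sum_mul_sq_le_sq_mul_sq _ _ _).trans ?_
  have h1 : ∑ f : Fin k → Fin n, ‖a (word f)‖ ^ 2 = sig a k ^ 2 := by
    rw [sig, Real.sq_sqrt (Finset.sum_nonneg fun _ _ => by positivity)]
  have h2 : (√r ^ k) ^ 2 = r ^ k := by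
    rw [← pow_mul, mul_comm, pow_mul, Real.sq_sqrt (norm_nonneg _)]
  rw [h1, mul_pow, mul_pow, h2, mul_assoc]
  gcongr
  exact sumsq_le X k x

lemma truncSumAdj_norm (b : Word n → ℂ) (X : Fin n → K →L[ℂ] K) (k : ℕ) :
    ‖truncSumAdj b X k‖ ≤ sig b k * √‖∑ i, X i * adjoint (X i)‖ ^ k := by
  refine opNorm_le_bound _ (mul_nonneg (Real.sqrt_nonneg _) (by positivity)) fun x => ?_
  refine le_trans ?_ (row_bound b X k x)
  simp only [truncSumAdj, _root_.sum_apply, smul_apply]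
  refine (norm_sum_le _ _).trans (Finset.sum_le_sum fun _ _ => ?_)
  rw [norm_smul]

lemma truncSum_eq (a : Word n → ℂ) (X : Fin n → K →L[ℂ] K) (k : ℕ) :
    truncSum a X k = star (truncSumAdj (fun w => star (a w)) X k) := by
  simp [truncSum, truncSumAdj, ← star_eq_adjoint, star_sum, star_smul]

lemma truncSum_norm (a : Word n → ℂ) (X : Fin n → K →L[ℂ] K) (k : ℕ) :
    ‖truncSum a X k‖ ≤ sig a k * √‖∑ i, X i * adjoint (X i)‖ ^ k := by
  rw [truncSum_eq, norm_star]
  refine (truncSumAdj_norm _ X k).trans_eq ?_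
  simp [sig]

end gen

lemma sig_summable {n : ℕ} (a : Word n → ℂ) (ha : radCond 1 a) (q : ℝ) (hq0 : 0 ≤ q) (hq : q < 1) :
    Summable (fun k => sig a k * q ^ k) := by
  obtain ⟨p, hp1, hpq⟩ : ∃ p : ℝ, 1 < p ∧ p * q < 1 := by
    refine ⟨2 / (1 + q), ?_, ?_⟩
    · rw [lt_div_iff₀ (by linarith)]; linarith
    · rw [div_mul_eq_mul_div, div_lt_one (by linarith)]; linarith
  have hlt : Filter.limsup
    (fun k : ℕ =>
      (∑ f : Fin k → Fin n, (‖a (word f)‖₊ : ℝ≥0∞) ^ 2) ^ ((1 : ℝ) / (2 * (k : ℝ))))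
      Filter.atTop < ENNReal.ofReal p := by
    refine lt_of_le_of_lt ha ?_
    rw [ENNReal.ofReal_lt_ofReal_iff (by linarith)]; simpa using hp1
  have hev := eventually_lt_of_limsup_lt hlt
  have hg : Summable (fun k : ℕ => (p * q) ^ k) :=
    summable_geometric_of_lt_one (by positivity) hpq
  refine Summable.of_norm_bounded_eventually_nat hg ?_
  filter_upwards [hev, eventually_gt_atTop 0] with k hk hk0
  have hs : 0 ≤ sig a k := Real.sqrt_nonneg _
  rw [Real.norm_of_nonneg (by positivity), mul_pow]
  gcongr
  rw [sig, Real.sqrt_le_left (by positivity)]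
  have hk0' : (0:ℝ) < k := by exact_mod_cast hk0
  have h1 : (∑ f : Fin k → Fin n, (‖a (word f)‖₊ : ℝ≥0∞) ^ 2) ≤ ENNReal.ofReal p ^ (2 * (k:ℝ)) := by
    have := ENNReal.rpow_le_rpow hk.le (by positivity : (0:ℝ) ≤ 2 * k)
    rwa [← ENNReal.rpow_mul, one_div_mul_cancel (by positivity), ENNReal.rpow_one] at this
  have h2 : (∑ f : Fin k → Fin n, (‖a (word f)‖₊ : ℝ≥0∞) ^ 2)
      = ENNReal.ofReal (∑ f : Fin k → Fin n, ‖a (word f)‖ ^ 2) := by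
    rw [ENNReal.ofReal_sum_of_nonneg (fun _ _ => by positivity)]
    refine Finset.sum_congr rfl fun f _ => ?_
    rw [ENNReal.ofReal_pow (norm_nonneg _), ofReal_norm]; rfl
  have h3 : ENNReal.ofReal p ^ (2 * (k:ℝ)) = ENNReal.ofReal ((p ^ k) ^ 2) := by
    rw [ENNReal.ofReal_rpow_of_pos (by linarith)]
    congr 1
    rw [← pow_mul, ← Real.rpow_natCast]; push_cast; ring_nf
  rw [h2, h3] at h1
  exact (ENNReal.ofReal_le_ofReal_iff (by positivity)).1 h1

lemma tann (v : ℕ → ℂ) (s : ℕ → ℝ) (err : ℕ → ℕ → ℂ) (hs : Summable s)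
    (hv : ∀ k, ‖v k‖ ≤ s k) (r : ℝ) (hr0 : 0 ≤ r) (hr : r < 1)
    (herr : ∀ m k, k < m → ‖err m k‖ ≤ s k * r ^ (m - k)) :
    Tendsto (fun m => ∑ k ∈ Finset.range m, (v k - err m k)) atTop (nhds (∑' k, v k)) := by
  have hs0 : ∀ k, 0 ≤ s k := fun k => (norm_nonneg _).trans (hv k)
  have key : ∀ m, ∑ k ∈ Finset.range m, (v k - err m k)
      = ∑' k, (if k < m then v k - err m k else 0) := by
    intro m
    rw [tsum_eq_sum (s := Finset.range m)]
    · refine Finset.sum_congr rfl fun k hk => ?_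
      rw [if_pos (Finset.mem_range.1 hk)]
    · intro k hk
      rw [if_neg (by simpa using hk)]
  simp only [key]
  refine tendsto_tsum_of_dominated_convergence (bound := fun k => 2 * s k) (hs.mul_left 2) ?_ ?_
  · intro k
    have : Tendsto (fun m => v k - err m k) atTop (nhds (v k - 0)) := by
      refine tendsto_const_nhds.sub ?_
      have h0 : Tendsto (fun m : ℕ => s k * r ^ (m - k)) atTop (nhds (s k * 0)) :=
        ((tendsto_pow_atTop_nhds_zero_of_lt_one hr0 hr).comp (tendsto_sub_atTop_nat k)).const_mul _
      rw [mul_zero] at h0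
      refine squeeze_zero_norm' ?_ h0
      filter_upwards [eventually_gt_atTop k] with m hm using herr m k hm
    rw [sub_zero] at this
    refine this.congr' ?_
    filter_upwards [eventually_gt_atTop k] with m hm
    rw [if_pos hm]
  · refine Eventually.of_forall fun m k => ?_
    split_ifs with h
    · refine (norm_sub_le _ _).trans ?_
      have := herr m k h
      have h1 : s k * r ^ (m - k) ≤ s k := mul_le_of_le_one_right (hs0 k) (pow_le_one₀ hr0 hr.le)
      linarith [hv k]
    · rw [norm_zero]; linarith [hs0 k]

section fock
variable {n : ℕ} {F : Type} [NormedAddCommGroup F] [InnerProductSpace ℂ F]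

open Classical in
/-- words of length at most m -/
def wset (n m : ℕ) : Finset (Word n) :=
  (Finset.range (m+1)).biUnion fun j => (Finset.univ : Finset (Fin j → Fin n)).image word

lemma mem_wset {m : ℕ} (α : Word n) : α ∈ wset n m ↔ wordLen α ≤ m := by
  simp only [wset, Finset.mem_biUnion, Finset.mem_range, Finset.mem_image, Finset.mem_univ, true_and]
  constructor
  · rintro ⟨j, hj, f, rfl⟩
    rw [wordLen_word]; omega
  · intro h
    exact ⟨wordLen α, by omega, exists_word α⟩

lemma sum_wset {M : Type*} [AddCommMonoid M] (m : ℕ) (g : Word n → M) :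
    ∑ γ ∈ wset n m, g γ = ∑ j ∈ Finset.range (m+1), ∑ f : Fin j → Fin n, g (word f) := by
  classical
  unfold wset
  rw [Finset.sum_biUnion]
  · refine Finset.sum_congr rfl fun j _ => ?_
    rw [Finset.sum_image (fun _ _ _ _ h => word_inj h)]
  · intro i _ j _ hij
    rw [Function.onFun, Finset.disjoint_left]
    intro w hw hw'
    simp only [Finset.mem_image, Finset.mem_univ, true_and] at hw hw'
    obtain ⟨f, rfl⟩ := hw
    obtain ⟨g, hg⟩ := hw'
    apply hij
    rw [← wordLen_word f, ← hg, wordLen_word]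

lemma Sm_word (e : HilbertBasis (Word n) ℂ F) (m : ℕ) (S : Fin n → F →L[ℂ] F)
    (hS : ∀ (i : Fin n) (α : Word n),
      S i (e α) = if wordLen α < m then e (FreeMonoid.of i * α) else 0) (β γ : Word n) :
    wordProd S β (e γ) = if wordLen β = 0 ∨ wordLen β + wordLen γ ≤ m then e (β * γ) else 0 := by
  induction β using FreeMonoid.inductionOn' with
  | one => simp [wordProd_one, wordLen_one]
  | of_mul i β ih =>
    rw [wordProd_mul, wordProd_of, mul_apply_eq_comp, ih]
    have hne : ¬ (1 + wordLen β = 0) := by omega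
    simp only [wordLen_mul, wordLen_of, hne, false_or]
    by_cases hb0 : wordLen β = 0
    · have hb : β = 1 := FreeMonoid.length_eq_zero.1 hb0
      subst hb
      simp only [true_or, if_true, hS, one_mul, wordLen_one, mul_one]
      congr 1
      exact propext (by omega)
    · simp only [hb0, false_or]
      by_cases h : wordLen β + wordLen γ ≤ m
      · rw [if_pos h, hS, wordLen_mul, mul_assoc]
        congr 1
        exact propext (by omega)
      · rw [if_neg h, map_zero, if_neg (by omega)]

set_option linter.unusedSectionVars false
variable [CompleteSpace F] {K : Type} [NormedAddCommGroup K] [InnerProductSpace ℂ K]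

/-- the kernel functional -/
def Lf (e : HilbertBasis (Word n) ℂ F) (m : ℕ) (c : Word n → K) : (F →L[ℂ] F) →ₗ[ℂ] ℂ where
  toFun A := ∑ γ ∈ wset n m, ∑ δ ∈ wset n m, inner ℂ (e δ) (A (e γ)) * inner ℂ (c δ) (c γ)
  map_add' A B := by
    simp [inner_add_right, add_mul, Finset.sum_add_distrib]
  map_smul' t A := by
    simp [inner_smul_right, mul_assoc, Finset.mul_sum]

lemma Lf_apply (e : HilbertBasis (Word n) ℂ F) (m : ℕ) (c : Word n → K) (A : F →L[ℂ] F) :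
    Lf e m c A = ∑ γ ∈ wset n m, ∑ δ ∈ wset n m,
      inner ℂ (e δ) (A (e γ)) * inner ℂ (c δ) (c γ) := rfl

lemma Lf_adjoint (e : HilbertBasis (Word n) ℂ F) (m : ℕ) (c : Word n → K) (A : F →L[ℂ] F) :
    Lf e m c (adjoint A) = star (Lf e m c A) := by
  simp only [Lf_apply, star_sum, star_mul']
  rw [Finset.sum_comm]
  refine Finset.sum_congr rfl fun γ _ => Finset.sum_congr rfl fun δ _ => ?_
  rw [adjoint_inner_right]
  simp only [← starRingEnd_apply, inner_conj_symm]

lemma Lf_pos (e : HilbertBasis (Word n) ℂ F) (m : ℕ) (c : Word n → K) (A : F →L[ℂ] F)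
    (hA : A.IsPositive) : 0 ≤ Lf e m c A := by
  rw [← nonneg_iff_isPositive] at hA
  obtain ⟨R, rfl⟩ := CStarAlgebra.nonneg_iff_eq_star_mul_self.mp hA
  have h : Lf e m c (star R * R) = inner ℂ (∑ δ ∈ wset n m, TensorProduct.tmul ℂ (R (e δ)) (c δ))
      (∑ δ ∈ wset n m, TensorProduct.tmul ℂ (R (e δ)) (c δ)) := by
    rw [Lf_apply]
    simp only [inner_sum, sum_inner, TensorProduct.inner_tmul]
    refine Finset.sum_congr rfl fun γ _ => Finset.sum_congr rfl fun δ _ => ?_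
    rw [mul_apply_eq_comp, star_eq_adjoint, adjoint_inner_right]
  rw [h]
  generalize (∑ δ ∈ wset n m, TensorProduct.tmul ℂ (R (e δ)) (c δ)) = z
  rw [Complex.nonneg_iff]
  refine ⟨inner_self_nonneg (𝕜 := ℂ) (x := z), ?_⟩
  exact (inner_self_im (𝕜 := ℂ) z).symm

lemma Lf_word (e : HilbertBasis (Word n) ℂ F) (m : ℕ) (S : Fin n → F →L[ℂ] F)
    (hS : ∀ (i : Fin n) (α : Word n),
      S i (e α) = if wordLen α < m then e (FreeMonoid.of i * α) else 0)
    [CompleteSpace K] (X : Fin n → K →L[ℂ] K) (B : K →L[ℂ] K) (hB : Df X = star B * B)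
    (h : K) (β : Word n) (hβ : wordLen β ≤ m) :
    Lf e m (fun γ => B (adjoint (wordProd X γ) h)) (wordProd S β)
      = inner ℂ (adjoint (wordProd X β) h) h
        - Gf X (m + 1 - wordLen β) (adjoint (wordProd X β) h) h := by
  classical
  rw [Lf_apply, ← Gf_defect_sum]
  have h1 : ∀ γ ∈ wset n m, ∑ δ ∈ wset n m, inner ℂ (e δ) (wordProd S β (e γ)) *
      inner ℂ (B (adjoint (wordProd X δ) h)) (B (adjoint (wordProd X γ) h))
      = if wordLen β + wordLen γ ≤ m then
        inner ℂ (adjoint (wordProd X γ) (adjoint (wordProd X β) h))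
          (Df X (adjoint (wordProd X γ) h)) else 0 := by
    intro γ hγ
    rw [mem_wset] at hγ
    have hor : (wordLen β = 0 ∨ wordLen β + wordLen γ ≤ m) ↔ wordLen β + wordLen γ ≤ m := by
      constructor
      · omega
      · exact Or.inr
    simp only [Sm_word e m S hS, hor]
    split_ifs with hc
    · rw [Finset.sum_eq_single (β * γ)]
      · rw [← adj_mul, orthonormal_iff_ite.1 e.orthonormal, if_pos rfl, one_mul, hB,
          mul_apply_eq_comp, star_eq_adjoint, adjoint_inner_right]
      · intro δ _ hδ
        rw [orthonormal_iff_ite.1 e.orthonormal, if_neg hδ, zero_mul]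
      · intro hn
        rw [mem_wset, wordLen_mul] at hn
        exact absurd hc hn
    · simp
  rw [Finset.sum_congr rfl h1, sum_wset m (fun γ => if wordLen β + wordLen γ ≤ m then
        inner ℂ (adjoint (wordProd X γ) (adjoint (wordProd X β) h))
          (Df X (adjoint (wordProd X γ) h)) else 0)]
  simp only [wordLen_word]
  symm
  refine Finset.sum_subset_zero_on_sdiff ?_ ?_ ?_
  · intro j hj
    simp only [Finset.mem_range] at hj ⊢
    omega
  · intro j hj
    simp only [Finset.mem_sdiff, Finset.mem_range] at hj
    refine Finset.sum_eq_zero fun f _ => ?_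
    rw [if_neg (by omega)]
  · intro j hj
    simp only [Finset.mem_range] at hj
    refine Finset.sum_congr rfl fun f _ => ?_
    rw [if_pos (by omega)]

end fock

lemma sum_Icc_shift {M : Type*} [AddCommMonoid M] (m : ℕ) (g : ℕ → M) :
    ∑ k ∈ Finset.Icc 1 m, g k = ∑ k ∈ Finset.range m, g (k+1) := by
  rw [Finset.range_eq_Ico, Finset.sum_Ico_add' g 0 m 1]
  rfl

lemma Df_pos {n : ℕ} {K : Type} [NormedAddCommGroup K] [InnerProductSpace ℂ K] [CompleteSpace K]
    (X : Fin n → K →L[ℂ] K) (hr : ‖∑ i, X i * adjoint (X i)‖ ≤ 1) : 0 ≤ Df X := by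
  have hsa : IsSelfAdjoint (∑ i, X i * adjoint (X i)) := by
    simp only [← star_eq_adjoint]
    exact isSelfAdjoint_sum _ fun i _ => IsSelfAdjoint.mul_star_self _
  rw [Df, sub_nonneg]
  exact (CStarAlgebra.norm_le_one_iff_of_nonneg _ (by
    simp only [← star_eq_adjoint]
    exact Finset.sum_nonneg fun i _ => mul_star_self_nonneg _)).1 hr

theorem back (n : ℕ)
    (F : Type) [NormedAddCommGroup F] [InnerProductSpace ℂ F] [CompleteSpace F]
    (e : HilbertBasis (Word n) ℂ F)
    (Sm : ℕ → Fin n → F →L[ℂ] F)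
    (hSm : ∀ (m : ℕ) (i : Fin n) (α : Word n),
      Sm m i (e α) = if wordLen α < m then e (FreeMonoid.of i * α) else 0)
    (a b : Word n → ℂ) (ha : radCond 1 a) (hb : radCond 1 b)
    (H : ∀ m : ℕ,
        ((∑ k ∈ Finset.Icc 1 m, truncSumAdj b (Sm m) k) + a 1 • (1 : F →L[ℂ] F) +
          ∑ k ∈ Finset.Icc 1 m, truncSum a (Sm m) k).IsPositive) : posPH 1 a b := by
  intro K _ _ _ X hX
  simp only [inBall, one_pow] at hX
  obtain ⟨B, hB⟩ := CStarAlgebra.nonneg_iff_eq_star_mul_self.mp (Df_pos X hX.le)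
  set r := ‖∑ i, X i * adjoint (X i)‖ with hr
  have hr0 : 0 ≤ r := norm_nonneg _
  have hq0 : 0 ≤ √r := Real.sqrt_nonneg _
  have hq1 : √r < 1 := by rw [Real.sqrt_lt' one_pos]; simpa using hX
  have sa := (summable_nat_add_iff 1).2 (sig_summable a ha _ hq0 hq1)
  have sb := (summable_nat_add_iff 1).2 (sig_summable b hb _ hq0 hq1)
  have suma : Summable (fun k => truncSum a X (k+1)) :=
    Summable.of_norm_bounded sa fun k => truncSum_norm a X (k+1)
  have sumb : Summable (fun k => truncSumAdj b X (k+1)) :=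
    Summable.of_norm_bounded sb fun k => truncSumAdj_norm b X (k+1)
  suffices hmain : ∀ h : K, 0 ≤ inner ℂ h (phOp a b X h) by
    rw [isPositive_iff_complex]
    intro x
    have h1 := hmain x
    have h2 : 0 ≤ inner ℂ (phOp a b X x) x := by
      rw [← inner_conj_symm, starRingEnd_apply]
      exact star_nonneg_iff.2 h1
    rw [Complex.nonneg_iff] at h2
    refine ⟨?_, h2.1⟩
    apply Complex.ext
    · simp
    · simpa using h2.2
  intro h
  let φ : (K →L[ℂ] K) →L[ℂ] ℂ := (innerSL ℂ h).comp (ContinuousLinearMap.apply ℂ K h)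
  have hφ : ∀ T, φ T = inner ℂ h (T h) := fun T => rfl
  have hφn : ∀ T, ‖φ T‖ ≤ ‖T‖ * ‖h‖ ^ 2 := by
    intro T
    rw [hφ]
    calc _ ≤ ‖h‖ * ‖T h‖ := norm_inner_le_norm _ _
      _ ≤ ‖h‖ * (‖T‖ * ‖h‖) := by gcongr; exact le_opNorm _ _
      _ = _ := by ring
  have hval : inner ℂ h (phOp a b X h) = (∑' k, φ (truncSumAdj b X (k+1))) + a 1 * inner ℂ h h
      + ∑' k, φ (truncSum a X (k+1)) := by
    rw [← hφ, phOp, map_add, map_add, φ.map_tsum suma, φ.map_tsum sumb, map_smul, hφ 1]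
    rfl
  let ea : ℕ → ℕ → ℂ := fun m k => ∑ f : Fin (k+1) → Fin n,
    a (word f) * Gf X (m - k) (adjoint (wordProd X (word f)) h) h
  let eb : ℕ → ℕ → ℂ := fun m k => ∑ f : Fin (k+1) → Fin n,
    b (word f) * star (Gf X (m - k) (adjoint (wordProd X (word f)) h) h)
  have hea : ∀ (c : Word n → ℂ) m k, ∑ f : Fin (k+1) → Fin n,
      ‖c (word f)‖ * ‖Gf X (m - k) (adjoint (wordProd X (word f)) h) h‖ ≤
      (sig c (k+1) * √r ^ (k+1)) * ‖h‖ ^ 2 * r ^ (m - k) := by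
    intro c m k
    calc _ ≤ ∑ f : Fin (k+1) → Fin n, (‖c (word f)‖ * ‖adjoint (wordProd X (word f)) h‖) *
            (r ^ (m - k) * ‖h‖) := by
          refine Finset.sum_le_sum fun f _ => ?_
          calc _ ≤ ‖c (word f)‖ * (r ^ (m - k) * (‖adjoint (wordProd X (word f)) h‖ * ‖h‖)) := by
                gcongr
                exact Gf_le X (m - k) _ _
            _ = _ := by ring
      _ ≤ (sig c (k+1) * √r ^ (k+1) * ‖h‖) * (r ^ (m - k) * ‖h‖) := by
          rw [← Finset.sum_mul]
          gcongr
          exact row_bound c X (k+1) h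
      _ = _ := by ring
  have ta := tann (fun k => φ (truncSum a X (k+1))) _ ea (sa.mul_right (‖h‖ ^ 2))
    (fun k => (hφn _).trans (by gcongr; exact truncSum_norm a X (k+1))) r hr0 hX
    (fun m k _ => (norm_sum_le _ _).trans (by simpa only [norm_mul] using hea a m k))
  have tb := tann (fun k => φ (truncSumAdj b X (k+1))) _ eb (sb.mul_right (‖h‖ ^ 2))
    (fun k => (hφn _).trans (by gcongr; exact truncSumAdj_norm b X (k+1))) r hr0 hX
    (fun m k _ => (norm_sum_le _ _).trans (by simpa only [norm_mul, norm_star] using hea b m k))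
  have t1 : Tendsto (fun m => a 1 * (inner ℂ h h - Gf X (m+1) h h)) atTop
      (nhds (a 1 * (inner ℂ h h - 0))) := by
    refine (tendsto_const_nhds.sub ?_).const_mul _
    have h0 : Tendsto (fun m : ℕ => r ^ (m+1) * (‖h‖ * ‖h‖)) atTop (nhds (0 * (‖h‖ * ‖h‖))) :=
      ((tendsto_pow_atTop_nhds_zero_of_lt_one hr0 hX).comp (tendsto_add_atTop_nat 1)).mul_const _
    rw [zero_mul] at h0
    exact squeeze_zero_norm (fun m => Gf_le X (m+1) h h) h0
  rw [sub_zero] at t1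
  rw [hval]
  refine ge_of_tendsto' ((tb.add t1).add ta) fun m => ?_
  have hp := Lf_pos e m (fun γ => B (adjoint (wordProd X γ) h)) _ (H m)
  convert hp using 1
  rw [map_add, map_add, map_sum, map_sum, map_smul, sum_Icc_shift, sum_Icc_shift]
  have hLw := Lf_word e m (Sm m) (hSm m) X B hB h
  congr 1
  · congr 1
    · refine Finset.sum_congr rfl fun k hk => ?_
      rw [Finset.mem_range] at hk
      simp only [truncSumAdj, map_sum, map_smul, eb]
      rw [← Finset.sum_sub_distrib]
      refine Finset.sum_congr rfl fun f _ => ?_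
      rw [Lf_adjoint, hLw _ (by rw [wordLen_word]; omega), wordLen_word, hφ, Nat.add_sub_add_right,
        star_sub, smul_eq_mul, smul_eq_mul, mul_sub,
        ← inner_conj_symm h, starRingEnd_apply]
    · have := hLw 1 (by rw [wordLen_one]; omega)
      rw [adj_one, wordProd_one, wordLen_one] at this
      rw [this]; rfl
  · refine Finset.sum_congr rfl fun k hk => ?_
    rw [Finset.mem_range] at hk
    simp only [truncSum, map_sum, map_smul, ea]
    rw [← Finset.sum_sub_distrib]
    refine Finset.sum_congr rfl fun f _ => ?_
    rw [hLw _ (by rw [wordLen_word]; omega), wordLen_word, hφ, Nat.add_sub_add_right,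
      smul_eq_mul, smul_eq_mul, mul_sub, adjoint_inner_left]

lemma hb_ext {n : ℕ} {F G : Type} [NormedAddCommGroup F] [InnerProductSpace ℂ F]
    [NormedAddCommGroup G] [InnerProductSpace ℂ G]
    (e : HilbertBasis (Word n) ℂ F) (A B : F →L[ℂ] G) (h : ∀ α, A (e α) = B (e α)) : A = B := by
  refine ContinuousLinearMap.ext_on (s := Set.range e) ?_ ?_
  · have := e.dense_span
    exact Submodule.dense_iff_topologicalClosure_eq_top.2 this
  · rintro _ ⟨α, rfl⟩
    exact h α

lemma wordProd_smul {n : ℕ} {K : Type} [NormedAddCommGroup K] [InnerProductSpace ℂ K] (t : ℂ)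
    (X : Fin n → K →L[ℂ] K) (α : Word n) :
    wordProd (fun i => t • X i) α = t ^ wordLen α • wordProd X α := by
  induction α using FreeMonoid.inductionOn' with
  | one => simp [wordProd_one, wordLen_one]
  | of_mul i β ih =>
    rw [wordProd_mul, wordProd_mul, wordProd_of, wordProd_of, ih, wordLen_mul, wordLen_of,
      smul_mul_smul_comm, pow_add, pow_one]

lemma Sm_row (n : ℕ)
    (F : Type) [NormedAddCommGroup F] [InnerProductSpace ℂ F] [CompleteSpace F]
    (e : HilbertBasis (Word n) ℂ F) (m : ℕ) (S : Fin n → F →L[ℂ] F)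
    (hS : ∀ (i : Fin n) (α : Word n),
      S i (e α) = if wordLen α < m then e (FreeMonoid.of i * α) else 0) :
    ‖∑ i, S i * adjoint (S i)‖ ≤ 1 := by
  classical
  have hon := orthonormal_iff_ite.1 e.orthonormal
  have hadj : ∀ i j α, adjoint (S i) (S j (e α)) =
      if i = j ∧ wordLen α < m then e α else 0 := by
    intro i j α
    apply e.repr.injective
    ext γ
    rw [e.repr_apply_apply, e.repr_apply_apply, adjoint_inner_right, hS, hS]
    by_cases h1 : wordLen α < m
    · by_cases hij : i = j
      · subst hij
        simp only [h1, if_true, and_self, hon]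
        by_cases hg : γ = α
        · subst hg; rw [if_pos h1, hon, if_pos rfl, if_pos rfl]
        · split_ifs <;> simp [hon, hg]
      · have : ¬ (FreeMonoid.of i * γ = FreeMonoid.of j * α) := by
          intro h
          have h' := congrArg FreeMonoid.toList h
          rw [FreeMonoid.toList_of_mul, FreeMonoid.toList_of_mul] at h'
          exact hij (List.cons.inj h').1
        simp only [h1, if_true, hij, false_and, if_false, inner_zero_right]
        split_ifs
        · rw [hon, if_neg this]
        · simp
    · simp [h1]
  have hT : ∀ j, (∑ i, S i * adjoint (S i)) * S j = S j := by
    intro j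
    refine hb_ext e _ _ fun α => ?_
    simp only [mul_apply_eq_comp, _root_.sum_apply, hadj]
    rw [Finset.sum_eq_single j]
    · simp only [true_and]
      split_ifs with h
      · rfl
      · rw [map_zero, hS, if_neg h]
    · intro i _ hij
      simp [hij]
    · simp
  have hp : IsStarProjection (∑ i, S i * adjoint (S i)) := by
    refine ⟨?_, ?_⟩
    · change _ * _ = _
      conv_lhs => rw [Finset.mul_sum]
      refine Finset.sum_congr rfl fun j _ => ?_
      rw [← mul_assoc, hT]
    · simp only [← star_eq_adjoint]
      exact isSelfAdjoint_sum _ fun i _ => IsSelfAdjoint.mul_star_self _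
  exact hp.norm_le

theorem forw (n : ℕ)
    (F : Type) [NormedAddCommGroup F] [InnerProductSpace ℂ F] [CompleteSpace F]
    (e : HilbertBasis (Word n) ℂ F) (m : ℕ) (S : Fin n → F →L[ℂ] F)
    (hS : ∀ (i : Fin n) (α : Word n),
      S i (e α) = if wordLen α < m then e (FreeMonoid.of i * α) else 0)
    (a b : Word n → ℂ) (H : posPH 1 a b) :
    ((∑ k ∈ Finset.Icc 1 m, truncSumAdj b S k) + a 1 • (1 : F →L[ℂ] F) +
          ∑ k ∈ Finset.Icc 1 m, truncSum a S k).IsPositive := by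
  let P : ℝ → (F →L[ℂ] F) := fun t =>
    (∑ k ∈ Finset.range m, (t:ℂ) ^ (k+1) • truncSumAdj b S (k+1)) + a 1 • (1 : F →L[ℂ] F) +
          ∑ k ∈ Finset.range m, (t:ℂ) ^ (k+1) • truncSum a S (k+1)
  have hP1 : P 1 = ((∑ k ∈ Finset.Icc 1 m, truncSumAdj b S k) + a 1 • (1 : F →L[ℂ] F) +
          ∑ k ∈ Finset.Icc 1 m, truncSum a S k) := by
    simp [P, sum_Icc_shift]
  have hPc : Continuous P := by
    fun_prop
  have hz : ∀ k, m < k → ∀ f : Fin k → Fin n, wordProd S (word f) = 0 := by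
    intro k hk f
    refine hb_ext e _ _ fun α => ?_
    rw [Sm_word e m S hS, if_neg]
    · rfl
    · rw [wordLen_word]
      omega
  have hpos : ∀ t : ℝ, 0 ≤ t → t < 1 → (P t).IsPositive := by
    intro t ht0 ht1
    have hball : inBall 1 (fun i => (t:ℂ) • S i) := by
      rw [inBall]
      have : ∑ i, ((t:ℂ) • S i) * adjoint ((t:ℂ) • S i) = ((t:ℂ)^2) • ∑ i, S i * adjoint (S i) := by
        rw [Finset.smul_sum]
        refine Finset.sum_congr rfl fun i _ => ?_
        rw [← star_eq_adjoint, star_smul, smul_mul_smul_comm, ← star_eq_adjoint]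
        simp [pow_two]
      rw [this, norm_smul]
      have h1 := Sm_row n F e m S hS
      have h2 : ‖(t:ℂ)^2‖ = t^2 := by
        rw [norm_pow, Complex.norm_real, Real.norm_of_nonneg ht0]
      rw [h2]
      calc t^2 * _ ≤ t^2 * 1 := by gcongr
        _ < 1 ^ 2 := by nlinarith
    have := H F _ hball
    convert this using 1
    have eA : ∀ k, truncSum a (fun i => (t:ℂ) • S i) k = (t:ℂ)^k • truncSum a S k := by
      intro k
      simp only [truncSum, Finset.smul_sum, wordProd_smul, wordLen_word]
      exact Finset.sum_congr rfl fun f _ => smul_comm _ _ _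
    have eB : ∀ k, truncSumAdj b (fun i => (t:ℂ) • S i) k = (t:ℂ)^k • truncSumAdj b S k := by
      intro k
      simp only [truncSumAdj, Finset.smul_sum, wordProd_smul, wordLen_word, ← star_eq_adjoint,
        star_smul]
      refine Finset.sum_congr rfl fun f _ => ?_
      rw [smul_comm]
      simp
    simp only [P, phOp, eA, eB]
    rw [tsum_eq_sum (s := Finset.range m), tsum_eq_sum (s := Finset.range m)]
    · intro k hk
      rw [Finset.mem_range] at hk
      simp only [truncSum]
      rw [Finset.sum_eq_zero, smul_zero]
      intro f _
      rw [hz _ (by omega), smul_zero]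
    · intro k hk
      rw [Finset.mem_range] at hk
      simp only [truncSumAdj]
      rw [Finset.sum_eq_zero, smul_zero]
      intro f _
      rw [hz _ (by omega), map_zero, smul_zero]
  rw [← hP1, isPositive_iff_complex]
  intro x
  have hc : Continuous fun t => inner ℂ (P t x) x := by fun_prop
  have h2 : 0 ≤ inner ℂ (P 1 x) x := by
    have ht : Tendsto (fun t => inner ℂ (P t x) x) (nhdsWithin 1 (Set.Iio 1))
        (nhds (inner ℂ (P 1 x) x)) := (hc.tendsto 1).mono_left nhdsWithin_le_nhds
    refine ge_of_tendsto ht ?_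
    filter_upwards [Ioo_mem_nhdsLT (show (0:ℝ) < 1 by norm_num)] with t ht
    exact (hpos t ht.1.le ht.2).inner_nonneg_left x
  rw [Complex.nonneg_iff] at h2
  refine ⟨?_, h2.1⟩
  apply Complex.ext
  · simp
  · simpa using h2.2

/-- A free pluriharmonic function is positive on the unit ball iff all its
compressions `Σ_{1 ≤ |α| ≤ m} b_α (S_α^{(m)})* + a_{g₀} I + Σ_{1 ≤ |α| ≤ m} a_α S_α^{(m)}`
are positive operators.  (Here `Sm m i` is the compression `S_i^{(m)}` of the left creation
operator to polynomials of degree `≤ m`, extended by `0`.) -/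
theorem stmt_14 (n : ℕ) (hn : 1 ≤ n)
    (F : Type) [NormedAddCommGroup F] [InnerProductSpace ℂ F] [CompleteSpace F]
    (e : HilbertBasis (Word n) ℂ F)
    (Sm : ℕ → Fin n → F →L[ℂ] F)
    (hSm : ∀ (m : ℕ) (i : Fin n) (α : Word n),
      Sm m i (e α) = if wordLen α < m then e (FreeMonoid.of i * α) else 0)
    (a b : Word n → ℂ) (ha : radCond 1 a) (hb : radCond 1 b) :
    posPH 1 a b ↔
      ∀ m : ℕ,
        ((∑ k ∈ Finset.Icc 1 m, truncSumAdj b (Sm m) k) + a 1 • (1 : F →L[ℂ] F) +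
          ∑ k ∈ Finset.Icc 1 m, truncSum a (Sm m) k).IsPositive := by
  exact ⟨fun H m => forw n F e m (Sm m) (hSm m) a b H,
    fun H => back n F e Sm hSm a b ha hb H⟩

end
end

section
/- Let u be the free pluriharmonic function with scalar coefficients (a, b) on the unit ball (γ = 1), and assume u is positive. Then a_{g₀} is a nonnegative real number, b_α = conj(a_α) for every |α| ≥ 1, and for every k ≥ 1 one has (Σ_{|α|=k} |a_α|²)^{1/2} ≤ a_{g₀}. -/
open scoped ENNReal ComplexOrder
open Filter ContinuousLinearMap

noncomputable section

/-- Words of length at most `k`. -/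
abbrev WIdx (n k : ℕ) := {l : List (Fin n) // l.length ≤ k}

instance instFintypeWIdx (n k : ℕ) : Fintype (WIdx n k) :=
  (List.finite_length_le (Fin n) k).fintype

/-- The matrix of the (scaled, truncated) creation operator by the word `w`. -/
def wMat (n k : ℕ) (r : ℝ) (w : List (Fin n)) : Matrix (WIdx n k) (WIdx n k) ℂ :=
  fun l l' => if l.1 = w ++ l'.1 then (r : ℂ) ^ w.length else 0

lemma wMat_nil (n k : ℕ) (r : ℝ) : wMat n k r [] = 1 := by
  ext l l'
  simp [wMat, Matrix.one_apply, Subtype.ext_iff]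

lemma wMat_cons (n k : ℕ) (r : ℝ) (i : Fin n) (w : List (Fin n)) :
    wMat n k r (i :: w) = wMat n k r [i] * wMat n k r w := by
  ext l l'
  rw [Matrix.mul_apply]
  by_cases h : l.1 = i :: (w ++ l'.1)
  · have hl : (w ++ l'.1).length ≤ k := by
      have := l.2
      rw [h] at this
      simp only [List.length_cons] at this
      omega
    rw [Finset.sum_eq_single ⟨w ++ l'.1, hl⟩]
    · simp [wMat, h, pow_succ, mul_comm]
    · intro m _ hm
      have : ¬ m.1 = w ++ l'.1 := fun h' => hm (Subtype.ext h')
      simp [wMat, this]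
    · simp
  · rw [Finset.sum_eq_zero]
    · simp [wMat, h]
    · intro m _
      by_cases h1 : m.1 = w ++ l'.1
      · have : ¬ l.1 = i :: m.1 := by rw [h1]; exact h
        simp [wMat, this]
      · simp [wMat, h1]

/-- The tuple of scaled truncated creation operators. -/
def opX (n k : ℕ) (r : ℝ) (i : Fin n) :
    EuclideanSpace ℂ (WIdx n k) →L[ℂ] EuclideanSpace ℂ (WIdx n k) :=
  Matrix.toEuclideanCLM (𝕜 := ℂ) (wMat n k r [i])

lemma opX_prod (n k : ℕ) (r : ℝ) (w : List (Fin n)) :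
    (w.map (opX n k r)).prod = Matrix.toEuclideanCLM (𝕜 := ℂ) (wMat n k r w) := by
  induction w with
  | nil => simp [wMat_nil]
  | cons i w ih => rw [List.map_cons, List.prod_cons, ih, wMat_cons, map_mul]; rfl

lemma opX_ball (n k : ℕ) (r : ℝ) (h0 : 0 ≤ r) (h1 : r < 1) : inBall 1 (opX n k r) := by
  have key : (∑ i, wMat n k r [i] * star (wMat n k r [i])) =
      Matrix.diagonal (fun l : WIdx n k => if l.1 = [] then (0:ℂ) else (r:ℂ)^2) := by
    ext l l'
    rw [Matrix.sum_apply, Matrix.diagonal_apply]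
    simp only [Matrix.mul_apply, Matrix.star_apply, wMat]
    rcases l with ⟨l, hl⟩
    rcases l' with ⟨l', hl'⟩
    cases l with
    | nil => simp
    | cons j t =>
      have ht : t.length ≤ k := by simp at hl; omega
      rw [Finset.sum_eq_single j, Finset.sum_eq_single ⟨t, ht⟩]
      · by_cases h : l' = j :: t
        · subst h; simp [pow_two]
        · have : ¬ (j :: t = l') := fun h' => h h'.symm
          simp [h, this]
      · intro m _ hm
        have : ¬ t = m.1 := fun h' => hm (Subtype.ext h'.symm)
        simp [this]
      · simp
      · intro i _ hi
        apply Finset.sum_eq_zero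
        intro m _
        simp [hi.symm]
      · simp
  have e : (∑ i, opX n k r i * adjoint (opX n k r i)) = Matrix.toEuclideanCLM (𝕜 := ℂ)
      (Matrix.diagonal (fun l : WIdx n k => if l.1 = [] then (0:ℂ) else (r:ℂ)^2)) := by
    rw [← key, map_sum]
    refine Finset.sum_congr rfl fun i _ => ?_
    rw [map_mul, map_star]; rfl
  unfold inBall
  rw [e]
  open scoped Matrix.Norms.L2Operator in
  rw [Matrix.l2_opNorm_toEuclideanCLM, Matrix.l2_opNorm_diagonal]
  refine lt_of_le_of_lt ((pi_norm_le_iff_of_nonneg (sq_nonneg r)).2 fun l => ?_)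
    (show r^2 < 1^2 by nlinarith)
  split_ifs
  · simpa using sq_nonneg r
  · simp

/-- The matrix of `truncSum`. -/
def tMat (n k : ℕ) (r : ℝ) (a : Word n → ℂ) (j : ℕ) : Matrix (WIdx n k) (WIdx n k) ℂ :=
  ∑ f : Fin j → Fin n, a (word f) • wMat n k r (List.ofFn f)

lemma tMat_apply (n k : ℕ) (r : ℝ) (a : Word n → ℂ) (j : ℕ) (l l' : WIdx n k) :
    tMat n k r a j l l' = ∑ f : Fin j → Fin n, a (word f) *
      (if l.1 = List.ofFn f ++ l'.1 then (r : ℂ) ^ j else 0) := by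
  simp [tMat, Matrix.sum_apply, wMat]

lemma tMat_zero_of (n k : ℕ) (r : ℝ) (a : Word n → ℂ) (j : ℕ) (l l' : WIdx n k)
    (h : l.1.length ≠ j + l'.1.length) : tMat n k r a j l l' = 0 := by
  rw [tMat_apply]
  refine Finset.sum_eq_zero fun f _ => ?_
  rw [if_neg, mul_zero]
  intro h'
  apply h
  rw [h']; simp

lemma tMat_zero (n k : ℕ) (r : ℝ) (a : Word n → ℂ) (j : ℕ) (h : k < j) :
    tMat n k r a j = 0 := by
  ext l l'
  have := l.2
  exact tMat_zero_of n k r a j l l' (by omega)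

lemma tMat_word (n k : ℕ) (r : ℝ) (a : Word n → ℂ) (f : Fin k → Fin n) (h h') :
    tMat n k r a k ⟨List.ofFn f, h⟩ ⟨[], h'⟩ = a (word f) * (r:ℂ)^k := by
  rw [tMat_apply, Finset.sum_eq_single f]
  · simp
  · intro g _ hg
    have : ¬ List.ofFn f = List.ofFn g := fun h => hg (List.ofFn_injective h).symm
    simp [this]
  · simp

lemma truncSum_opX (n k : ℕ) (r : ℝ) (a : Word n → ℂ) (j : ℕ) :
    truncSum a (opX n k r) j = Matrix.toEuclideanCLM (𝕜 := ℂ) (tMat n k r a j) := by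
  unfold truncSum tMat
  rw [map_sum]
  refine Finset.sum_congr rfl fun f _ => ?_
  rw [map_smul, ← opX_prod]; rfl

lemma truncSumAdj_opX (n k : ℕ) (r : ℝ) (b : Word n → ℂ) (j : ℕ) :
    truncSumAdj b (opX n k r) j =
      Matrix.toEuclideanCLM (𝕜 := ℂ) (star (tMat n k r (fun w => star (b w)) j)) := by
  unfold truncSumAdj tMat
  rw [star_sum, map_sum]
  refine Finset.sum_congr rfl fun f _ => ?_
  rw [star_smul, star_star, map_smul, map_star, ← opX_prod]; rfl

/-- The matrix of `phOp`. -/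
def uMat (n k : ℕ) (r : ℝ) (a b : Word n → ℂ) : Matrix (WIdx n k) (WIdx n k) ℂ :=
  (∑ j ∈ Finset.range k, star (tMat n k r (fun w => star (b w)) (j+1))) + a 1 • 1 +
    ∑ j ∈ Finset.range k, tMat n k r a (j+1)

lemma phOp_opX (n k : ℕ) (r : ℝ) (a b : Word n → ℂ) :
    phOp a b (opX n k r) = Matrix.toEuclideanCLM (𝕜 := ℂ) (uMat n k r a b) := by
  unfold phOp uMat
  rw [tsum_eq_sum (s := Finset.range k), tsum_eq_sum (s := Finset.range k)]
  · rw [map_add, map_add, map_sum, map_sum, map_smul, map_one]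
    simp only [truncSum_opX, truncSumAdj_opX]
  · intro j hj
    rw [truncSum_opX, tMat_zero _ _ _ _ _ (by simp at hj; omega), map_zero]
  · intro j hj
    rw [truncSumAdj_opX, tMat_zero _ _ _ _ _ (by simp at hj; omega), star_zero, map_zero]

lemma uMat_apply (n k : ℕ) (r : ℝ) (a b : Word n → ℂ) (l l' : WIdx n k) :
    uMat n k r a b l l' =
      (∑ j ∈ Finset.range k, star (tMat n k r (fun w => star (b w)) (j+1) l' l)) +
      a 1 * (if l = l' then 1 else 0) +
    ∑ j ∈ Finset.range k, tMat n k r a (j+1) l l' := by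
  simp only [uMat, Matrix.add_apply, Matrix.sum_apply, Matrix.star_apply, Matrix.smul_apply,
    Matrix.one_apply, smul_eq_mul]

lemma uMat_same (n k : ℕ) (r : ℝ) (a b : Word n → ℂ) (l l' : WIdx n k)
    (h : l.1.length = l'.1.length) :
    uMat n k r a b l l' = if l = l' then a 1 else 0 := by
  rw [uMat_apply, Finset.sum_eq_zero, Finset.sum_eq_zero]
  · simp
  · intro j _
    exact tMat_zero_of _ _ _ _ _ _ _ (by omega)
  · intro j _
    rw [tMat_zero_of _ _ _ _ _ _ _ (by omega), star_zero]

lemma uMat_left (n k : ℕ) (hk : 1 ≤ k) (r : ℝ) (a b : Word n → ℂ) (f : Fin k → Fin n) (h h') :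
    uMat n k r a b ⟨List.ofFn f, h⟩ ⟨[], h'⟩ = a (word f) * (r:ℂ)^k := by
  obtain ⟨m, rfl⟩ : ∃ m, k = m + 1 := ⟨k - 1, by omega⟩
  rw [uMat_apply, Finset.sum_eq_zero, Finset.sum_eq_single m, tMat_word, if_neg]
  · simp
  · simp
  · intro j _ hj
    exact tMat_zero_of _ _ _ _ _ _ _ (by simp; omega)
  · simp
  · intro j _
    rw [tMat_zero_of _ _ _ _ _ _ _ (by simp), star_zero]

lemma uMat_right (n k : ℕ) (hk : 1 ≤ k) (r : ℝ) (a b : Word n → ℂ) (f : Fin k → Fin n) (h h') :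
    uMat n k r a b ⟨[], h'⟩ ⟨List.ofFn f, h⟩ = b (word f) * (r:ℂ)^k := by
  obtain ⟨m, rfl⟩ : ∃ m, k = m + 1 := ⟨k - 1, by omega⟩
  rw [uMat_apply, Finset.sum_eq_single m, Finset.sum_eq_zero, tMat_word, if_neg]
  · simp
  · simp
  · intro j _
    exact tMat_zero_of _ _ _ _ _ _ _ (by simp)
  · intro j _ hj
    rw [tMat_zero_of _ _ _ _ _ _ _ (by simp; omega), star_zero]
  · simp

lemma uMat_pos (n k : ℕ) (r : ℝ) (h0 : 0 ≤ r) (h1 : r < 1) (a b : Word n → ℂ)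
    (hpos : posPH 1 a b) : (uMat n k r a b).PosSemidef := by
  have h := hpos _ _ (opX_ball n k r h0 h1)
  rw [phOp_opX] at h
  rw [← Matrix.isPositive_toEuclideanLin_iff]
  exact h.toLinearMap

/-- The index map. -/
def eIdx (n k : ℕ) : Option (Fin k → Fin n) → WIdx n k
  | none => ⟨[], by simp⟩
  | some f => ⟨List.ofFn f, by simp⟩

lemma b_eq (n k : ℕ) (hk : 1 ≤ k) (a b : Word n → ℂ) (hpos : posPH 1 a b) (f : Fin k → Fin n) :
    b (word f) = (starRingEnd ℂ) (a (word f)) := by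
  have h := (uMat_pos n k (1/2) (by norm_num) (by norm_num) a b hpos).isHermitian
  have h2 := h.apply ⟨[], by simp⟩ ⟨List.ofFn f, by simp⟩
  rw [uMat_left n k hk, uMat_right n k hk] at h2
  have h3 : ((((1/2 : ℝ)) : ℂ)^k) ≠ 0 := by
    apply pow_ne_zero; norm_num
  apply mul_right_cancel₀ h3
  rw [← h2]
  simp

lemma norm_le (n k : ℕ) (hk : 1 ≤ k) (a b : Word n → ℂ) (hpos : posPH 1 a b) (r : ℝ)
    (h0 : 0 ≤ r) (h1 : r < 1) (hre : 0 ≤ (a 1).re) :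
    r ^ k * Real.sqrt (∑ f : Fin k → Fin n, ‖a (word f)‖ ^ 2) ≤ (a 1).re := by
  set N : ℝ := ∑ f : Fin k → Fin n, ‖a (word f)‖ ^ 2 with hN
  have hN0 : 0 ≤ N := by positivity
  rcases hN0.eq_or_lt with h | hNpos
  · rw [← h]; simpa using hre
  have P := (uMat_pos n k r h0 h1 a b hpos).submatrix (eIdx n k)
  have Q := P.dotProduct_mulVec_nonneg
    (fun o => Option.elim o ((Real.sqrt N : ℝ) : ℂ) (fun f => - a (word f)))
  have hss : ∀ f g : Fin k → Fin n, uMat n k r a b (eIdx n k (some f)) (eIdx n k (some g)) =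
      if f = g then a 1 else 0 := by
    intro f g
    rw [uMat_same _ _ _ _ _ _ _ (by simp [eIdx])]
    simp [eIdx]
  have hnn : uMat n k r a b (eIdx n k none) (eIdx n k none) = a 1 := by
    rw [uMat_same _ _ _ _ _ _ _ rfl]; simp
  have hsn : ∀ f, uMat n k r a b (eIdx n k (some f)) (eIdx n k none) = a (word f) * (r:ℂ)^k :=
    fun f => uMat_left n k hk r a b f _ _
  have hns : ∀ f, uMat n k r a b (eIdx n k none) (eIdx n k (some f)) =
      (starRingEnd ℂ) (a (word f)) * (r:ℂ)^k := by
    intro f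
    rw [← b_eq n k hk a b hpos f]
    exact uMat_right n k hk r a b f _ _
  have hNC : (∑ f : Fin k → Fin n, (starRingEnd ℂ) (a (word f)) * a (word f)) = (N : ℂ) := by
    rw [hN]; push_cast
    exact Finset.sum_congr rfl fun f _ => Complex.conj_mul' _
  have hs : Real.sqrt N * Real.sqrt N = N := Real.mul_self_sqrt hN0
  have E : 0 ≤ (2 * (N : ℂ)) * (a 1 - ((r ^ k * Real.sqrt N : ℝ) : ℂ)) := by
    refine Q.trans_eq ?_
    have hsC : ((Real.sqrt N : ℝ) : ℂ) * ((Real.sqrt N : ℝ) : ℂ) = N := by exact_mod_cast hs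
    simp only [dotProduct, Matrix.mulVec, Fintype.sum_option, Matrix.submatrix_apply, hss, hnn,
      hsn, hns, Option.elim, Pi.star_apply, ite_mul, zero_mul, Finset.sum_ite_eq,
      Finset.mem_univ, if_true]
    have e1 : (∑ x : Fin k → Fin n, (starRingEnd ℂ) (a (word x)) * (r:ℂ) ^ k * -a (word x)) = - (N * (r:ℂ)^k) := by
      rw [← hNC, Finset.sum_mul, ← Finset.sum_neg_distrib]
      exact Finset.sum_congr rfl fun f _ => by ring
    have e2 : (∑ x : Fin k → Fin n, star (-a (word x)) *
        (a (word x) * (r:ℂ) ^ k * ((Real.sqrt N : ℝ) : ℂ) + a 1 * -a (word x))) =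
        N * (a 1 - (r:ℂ)^k * ((Real.sqrt N : ℝ) : ℂ)) := by
      rw [← hNC, Finset.sum_mul]
      refine Finset.sum_congr rfl fun f _ => ?_
      rw [star_neg, ← starRingEnd_apply]; ring
    rw [e1, e2]
    have : star ((Real.sqrt N : ℝ) : ℂ) = ((Real.sqrt N : ℝ) : ℂ) := Complex.conj_ofReal _
    rw [this]; push_cast
    linear_combination (a 1) * hsC
  have E2 := (Complex.le_def.1 E).1
  have : ((2 * (N : ℂ)) * (a 1 - ((r ^ k * Real.sqrt N : ℝ) : ℂ))).re =
      2 * N * ((a 1).re - r^k * Real.sqrt N) := by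
    have : (2 * (N : ℂ)) = ((2 * N : ℝ) : ℂ) := by push_cast; rfl
    rw [this, Complex.re_ofReal_mul, Complex.sub_re, Complex.ofReal_re]
  rw [this, Complex.zero_re] at E2
  have := nonneg_of_mul_nonneg_right E2 (by positivity)
  linarith

/-- For a positive free pluriharmonic function: the constant coefficient is
a nonnegative real, `b_α = conj (a_α)`, and `(Σ_{|α|=k} |a_α|²)^{1/2} ≤ a_{g₀}` for `k ≥ 1`. -/
theorem stmt_15 (n : ℕ) (hn : 1 ≤ n)
    (a b : Word n → ℂ) (ha : radCond 1 a) (hb : radCond 1 b)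
    (hpos : posPH 1 a b) :
    (0 ≤ (a 1).re ∧ (a 1).im = 0) ∧
    (∀ α : Word n, 1 ≤ wordLen α → b α = (starRingEnd ℂ) (a α)) ∧
    (∀ k : ℕ, 1 ≤ k →
      Real.sqrt (∑ f : Fin k → Fin n, ‖a (word f)‖ ^ 2) ≤ (a 1).re) := by
  have h00 : 0 ≤ a 1 := by
    have h := (uMat_pos n 0 (1/2) (by norm_num) (by norm_num) a b hpos).diag_nonneg
      (i := ⟨[], by simp⟩)
    rw [uMat_same _ _ _ _ _ _ _ rfl] at h
    simpa using h
  have h01 := Complex.le_def.1 h00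
  have hre : 0 ≤ (a 1).re := h01.1
  refine ⟨⟨hre, h01.2.symm⟩, ?_, ?_⟩
  · intro α hα
    have e : α = word (FreeMonoid.toList α).get := by
      unfold word
      rw [List.ofFn_get]; rfl
    rw [e]
    exact b_eq n _ hα a b hpos _
  · intro k hk
    have ht : Tendsto (fun r : ℝ => r ^ k * Real.sqrt (∑ f : Fin k → Fin n, ‖a (word f)‖ ^ 2))
        (nhdsWithin 1 (Set.Iio 1))
        (nhds ((1:ℝ) ^ k * Real.sqrt (∑ f : Fin k → Fin n, ‖a (word f)‖ ^ 2))) :=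
      (Continuous.tendsto (by fun_prop) 1).mono_left nhdsWithin_le_nhds
    rw [one_pow, one_mul] at ht
    refine le_of_tendsto ht ?_
    filter_upwards [Ioo_mem_nhdsLT (show (0:ℝ) < 1 by norm_num)] with r hr
    exact norm_le n k hk a b hpos r hr.1.le hr.2 hre

end
end

section
/- Let f be the free holomorphic function with scalar coefficients a = (a_α)_{α∈𝔽ₙ⁺} on the unit ball (γ = 1). Then f_K(X) + f_K(X)* ≥ 0 for every complex Hilbert space K and every X ∈ [B(K)ⁿ]₁ if and only if the kernel K_f : 𝔽ₙ⁺ × 𝔽ₙ⁺ → ℂ, defined by K_f(α, β) := conj(a_{σ̃}) if β = ασ for some word σ with |σ| ≥ 1, K_f(α, β) := a_{g₀} + conj(a_{g₀}) if α = β, K_f(α, β) := a_{σ̃} if α = βσ for some word σ with |σ| ≥ 1, and K_f(α, β) := 0 otherwise (σ̃ denoting the reverse of σ), is positive semidefinite, i.e., Σ_{α,β ∈ 𝔽ₙ⁺} conj(h_α) K_f(α, β) h_β ≥ 0 for every finitely supported h : 𝔽ₙ⁺ → ℂ. -/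
open scoped ENNReal ComplexOrder
open Filter ContinuousLinearMap

noncomputable section

open Classical in
/-- The multi-Toeplitz kernel `K_f` associated with the coefficients `a`:
`K_f(α, β) = conj (a_{σ̃})` if `β = α σ` with `|σ| ≥ 1`, `a_{g₀} + conj (a_{g₀})` if
`α = β`, `a_{σ̃}` if `α = β σ` with `|σ| ≥ 1`, and `0` otherwise. -/
noncomputable def caraKer {n : ℕ} (a : Word n → ℂ) (α β : Word n) : ℂ :=
  if α = β then a 1 + (starRingEnd ℂ) (a 1)
  else if FreeMonoid.toList α <+: FreeMonoid.toList β then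
    (starRingEnd ℂ)
      (a (FreeMonoid.ofList
        (((FreeMonoid.toList β).drop (FreeMonoid.toList α).length).reverse)))
  else if FreeMonoid.toList β <+: FreeMonoid.toList α then
    a (FreeMonoid.ofList
      (((FreeMonoid.toList α).drop (FreeMonoid.toList β).length).reverse))
  else 0

namespace Cara

def W (n M : ℕ) : Finset (List (Fin n)) := (List.finite_length_lt (Fin n) M).toFinset

lemma mem_W {n M : ℕ} {l : List (Fin n)} : l ∈ W n M ↔ l.length < M := by
  simp [W]

lemma sum_W {n : ℕ} {E : Type*} [AddCommMonoid E] (M : ℕ) (g : List (Fin n) → E) :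
    ∑ l ∈ W n M, g l = ∑ k ∈ Finset.range M, ∑ f : Fin k → Fin n, g (List.ofFn f) := by
  rw [Finset.sum_sigma']
  symm
  refine Finset.sum_bij (fun p _ => List.ofFn p.2) ?_ ?_ ?_ ?_
  · rintro ⟨k, f⟩ h
    simpa [mem_W] using h
  · rintro ⟨k, f⟩ h ⟨k', f'⟩ h' e
    have : k = k' := by simpa using congrArg List.length e
    subst this
    have := List.ofFn_injective e
    simp_all
  · intro l hl
    refine ⟨⟨l.length, l.get⟩, by simpa [mem_W] using hl, by simp⟩
  · intros; rfl

lemma sum_W_succ {n : ℕ} {E : Type*} [AddCommMonoid E] (M : ℕ) (g : List (Fin n) → E) :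
    ∑ l ∈ W n (M+1), g l = ∑ l ∈ W n M, g l + ∑ f : Fin M → Fin n, g (List.ofFn f) := by
  rw [sum_W, sum_W, Finset.sum_range_succ]

open Classical in
def L {n : ℕ} (a : Word n → ℂ) (α β : List (Fin n)) : ℂ :=
  if β <:+ α then a (FreeMonoid.ofList (α.take (α.length - β.length))) else 0

lemma ker_eq {n : ℕ} (a : Word n → ℂ) (α β : List (Fin n)) :
    caraKer a (FreeMonoid.ofList α.reverse) (FreeMonoid.ofList β.reverse)
      = L a α β + (starRingEnd ℂ) (L a β α) := by
  unfold caraKer L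
  simp only [FreeMonoid.toList_ofList, List.reverse_prefix, List.length_reverse, List.drop_reverse,
    List.reverse_reverse, EmbeddingLike.apply_eq_iff_eq, List.reverse_inj]
  by_cases h : α = β
  · subst h
    simp
  · by_cases h1 : α <:+ β
    · have h2 : ¬ β <:+ α := fun h2 => h (h1.eq_of_length_le h2.length_le)
      simp [h, h1, h2]
    · simp [h, h1]

lemma L_sum {n : ℕ} (a : Word n → ℂ) (M : ℕ) (g : List (Fin n) → List (Fin n) → ℂ) :
    ∑ α ∈ W n M, ∑ β ∈ W n M, L a α β * g α β =
      ∑ k ∈ Finset.range M, ∑ f : Fin k → Fin n, a (word f) *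
        ∑ β ∈ W n (M - k), g (List.ofFn f ++ β) β := by
  classical
  have h1 : ∑ k ∈ Finset.range M, ∑ f : Fin k → Fin n, a (word f) *
        ∑ β ∈ W n (M - k), g (List.ofFn f ++ β) β
      = ∑ σ ∈ W n M, ∑ β ∈ W n (M - σ.length), a (FreeMonoid.ofList σ) * g (σ ++ β) β := by
    rw [sum_W]
    refine Finset.sum_congr rfl fun k _ => Finset.sum_congr rfl fun f _ => ?_
    rw [Finset.mul_sum]
    simp [word]
  rw [h1, Finset.sum_sigma', Finset.sum_sigma']
  symm
  refine Finset.sum_bij_ne_zero (fun p _ _ => ⟨p.1 ++ p.2, p.2⟩) ?_ ?_ ?_ ?_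
  · rintro ⟨σ, β⟩ h _
    simp only [Finset.mem_sigma, mem_W, List.length_append] at h ⊢
    omega
  · rintro ⟨σ, β⟩ h _ ⟨σ', β'⟩ h' _ e
    simp only [Sigma.mk.injEq, heq_eq_eq] at e
    obtain ⟨e1, e2⟩ := e
    subst e2
    simp_all
  · rintro ⟨α, β⟩ h hne
    simp only [Finset.mem_sigma, mem_W] at h
    have hs : β <:+ α := by
      by_contra hs
      simp [L, hs] at hne
    obtain ⟨σ, rfl⟩ := hs
    simp only [List.length_append] at h
    refine ⟨⟨σ, β⟩, ?_, ?_, rfl⟩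
    · simp only [Finset.mem_sigma, mem_W]; omega
    · simpa [L] using hne
  · rintro ⟨σ, β⟩ h _
    simp [L]

/-- passing between finite sets of words and `W`. -/
lemma cond_W {n : ℕ} (a : Word n → ℂ)
    (hp : ∀ (s : Finset (Word n)) (h : Word n → ℂ),
      0 ≤ ∑ α ∈ s, ∑ β ∈ s, (starRingEnd ℂ) (h α) * caraKer a α β * h β)
    (M : ℕ) (H : List (Fin n) → ℂ) :
    0 ≤ ∑ α ∈ W n M, ∑ β ∈ W n M, (starRingEnd ℂ) (H α) *
      (L a α β + (starRingEnd ℂ) (L a β α)) * H β := by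
  classical
  have inj : Set.InjOn (fun l : List (Fin n) => (FreeMonoid.ofList l.reverse : Word n)) (W n M) := by
    intro x _ y _ e
    simpa using e
  have := hp ((W n M).image (fun l => FreeMonoid.ofList l.reverse))
    (fun w => H (FreeMonoid.toList w).reverse)
  rw [Finset.sum_image inj] at this
  simp_rw [Finset.sum_image inj] at this
  simpa [ker_eq] using this

lemma cond_of_W {n : ℕ} (a : Word n → ℂ)
    (hp : ∀ (M : ℕ) (H : List (Fin n) → ℂ),
    0 ≤ ∑ α ∈ W n M, ∑ β ∈ W n M, (starRingEnd ℂ) (H α) *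
      (L a α β + (starRingEnd ℂ) (L a β α)) * H β)
    (s : Finset (Word n)) (h : Word n → ℂ) :
      0 ≤ ∑ α ∈ s, ∑ β ∈ s, (starRingEnd ℂ) (h α) * caraKer a α β * h β := by
  classical
  set M := s.sup wordLen + 1 with hM
  have inj : Set.InjOn (fun l : List (Fin n) => (FreeMonoid.ofList l.reverse : Word n)) (W n M) := by
    intro x _ y _ e
    simpa using e
  have hsub : s ⊆ (W n M).image (fun l => FreeMonoid.ofList l.reverse) := by
    intro w hw
    rw [Finset.mem_image]
    refine ⟨(FreeMonoid.toList w).reverse, ?_, by simp⟩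
    have := Finset.le_sup (f := wordLen) hw
    rw [mem_W, List.length_reverse]
    change (FreeMonoid.toList w).length ≤ _ at this
    omega
  have key := hp M (fun l => if FreeMonoid.ofList l.reverse ∈ s then h (FreeMonoid.ofList l.reverse) else 0)
  simp_rw [← ker_eq] at key
  have e1 : ∑ α ∈ (W n M).image (fun l => (FreeMonoid.ofList l.reverse : Word n)),
      ∑ β ∈ (W n M).image (fun l => (FreeMonoid.ofList l.reverse : Word n)),
      (starRingEnd ℂ) (if α ∈ s then h α else 0) * caraKer a α β * (if β ∈ s then h β else 0)
      = _ := (Finset.sum_image inj).trans (Finset.sum_congr rfl fun α _ => Finset.sum_image inj)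
  rw [← e1] at key
  refine key.trans_eq ?_
  symm
  apply Finset.sum_subset_zero_on_sdiff hsub
  · intro x hx
    rw [Finset.mem_sdiff] at hx
    simp [hx.2]
  · intro x hx
    apply Finset.sum_subset_zero_on_sdiff hsub
    · intro y hy
      rw [Finset.mem_sdiff] at hy
      simp [hy.2]
    · intro y hy
      simp [hx, hy]

section fwd
variable {n : ℕ}

def Mt (M : ℕ) (r : ℝ) (l : List (Fin n)) : Matrix (W n M) (W n M) ℂ :=
  Matrix.of fun γ β => if (γ : List (Fin n)) = l ++ (β : List (Fin n)) then (r : ℂ) ^ l.length else 0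

lemma Mt_nil (M : ℕ) (r : ℝ) : Mt (n := n) M r [] = 1 := by
  ext γ β
  by_cases h : γ = β
  · subst h; simp [Mt]
  · have h' : ¬ (γ : List (Fin n)) = (β : List (Fin n)) := fun e => h (Subtype.ext e)
    simp [Mt, h, h']

lemma Mt_cons (M : ℕ) (r : ℝ) (i : Fin n) (l : List (Fin n)) :
    Mt M r (i :: l) = Mt M r [i] * Mt M r l := by
  ext γ β
  rw [Matrix.mul_apply]
  simp only [Mt, Matrix.of_apply]
  by_cases h : (γ : List (Fin n)) = i :: l ++ (β : List (Fin n))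
  · have hm : l ++ (β : List (Fin n)) ∈ W n M := by
      have := mem_W.1 γ.2
      rw [h] at this
      rw [mem_W]
      simp at this ⊢
      omega
    rw [Finset.sum_eq_single ⟨l ++ (β : List (Fin n)), hm⟩]
    · simp [h, pow_succ, mul_comm]
    · intro b _ hb
      have : ¬ ((b : List (Fin n)) = l ++ (β : List (Fin n))) := fun e => hb (Subtype.ext e)
      simp [this]
    · simp
  · rw [if_neg h]
    symm
    apply Finset.sum_eq_zero
    intro b _
    by_cases h1 : (b : List (Fin n)) = l ++ (β : List (Fin n))
    · have : ¬ ((γ : List (Fin n)) = [i] ++ (b : List (Fin n))) := by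
        rw [h1]; simpa using h
      rw [if_neg this, zero_mul]
    · simp [h1]

def Xf (M : ℕ) (r : ℝ) (i : Fin n) : EuclideanSpace ℂ (W n M) →L[ℂ] EuclideanSpace ℂ (W n M) :=
  Matrix.toEuclideanCLM (𝕜 := ℂ) (Mt M r [i])

lemma prod_Xf (M : ℕ) (r : ℝ) (l : List (Fin n)) :
    (l.map (Xf M r)).prod = Matrix.toEuclideanCLM (𝕜 := ℂ) (Mt M r l) := by
  induction l with
  | nil => simp [Mt_nil]
  | cons i l ih => rw [List.map_cons, List.prod_cons, ih, Mt_cons, map_mul]; rfl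

open scoped Matrix.Norms.L2Operator in
lemma Xf_ball (M : ℕ) (r : ℝ) (hr : 0 ≤ r) (hr1 : r < 1) : inBall 1 (Xf (n := n) M r) := by
  unfold inBall
  have h1 : ∑ i, Xf (n := n) M r i * adjoint (Xf M r i)
      = Matrix.toEuclideanCLM (𝕜 := ℂ) (∑ i, Mt (n := n) M r [i] * (Mt M r [i]).conjTranspose) := by
    rw [map_sum]
    refine Finset.sum_congr rfl fun i _ => ?_
    rw [map_mul, ← Matrix.star_eq_conjTranspose, map_star]
    rfl
  have h2 : (∑ i, Mt (n := n) M r [i] * (Mt M r [i]).conjTranspose)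
      = Matrix.diagonal (fun γ : W n M => if (γ : List (Fin n)) = [] then (0:ℂ) else (r:ℂ)^2) := by
    ext γ β
    rw [Matrix.sum_apply]
    simp only [Matrix.mul_apply, Matrix.conjTranspose_apply, Mt, Matrix.of_apply]
    obtain ⟨γ, hγ⟩ := γ
    cases γ with
    | nil =>
      simp [Matrix.diagonal_apply]
    | cons j t =>
      have ht : t ∈ W n M := by
        rw [mem_W] at hγ ⊢
        simp at hγ
        omega
      rw [Finset.sum_eq_single j, Finset.sum_eq_single ⟨t, ht⟩]
      · obtain ⟨β, hβ⟩ := β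
        by_cases e : j :: t = β
        · subst e
          simp [sq]
        · have e' : ¬ β = j :: t := fun h => e h.symm
          simp [Matrix.diagonal_apply, e, e']
      · rintro ⟨b, hb⟩ _ hne
        have : ¬ t = b := by rintro rfl; exact hne rfl
        simp [this]
      · simp
      · intro i _ hi
        have : ¬ j = i := fun h => hi h.symm
        simp [this]
      · simp
  rw [h1, h2, ← Matrix.cstar_norm_def, Matrix.l2_opNorm_diagonal]
  refine lt_of_le_of_lt ?_ (show r^2 < 1^2 by nlinarith)
  rw [pi_norm_le_iff_of_nonneg (by positivity)]
  intro γ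
  split_ifs
  · simp; positivity
  · simp

def vec (M : ℕ) (H : List (Fin n) → ℂ) : EuclideanSpace ℂ (W n M) :=
  WithLp.toLp 2 fun γ => H γ

lemma inner_Mt (M : ℕ) (r : ℝ) (H : List (Fin n) → ℂ) (l : List (Fin n)) :
    inner ℂ (vec M H) (Matrix.toEuclideanCLM (𝕜 := ℂ) (Mt M r l) (vec M H))
      = (r : ℂ) ^ l.length * ∑ β ∈ W n (M - l.length), (starRingEnd ℂ) (H (l ++ β)) * H β := by
  have h0 : inner ℂ (vec M H) (Matrix.toEuclideanCLM (𝕜 := ℂ) (Mt M r l) (vec M H))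
     = ∑ γ : W n M, ∑ β : W n M, (starRingEnd ℂ) (H γ) *
        ((if (γ : List (Fin n)) = l ++ (β : List (Fin n)) then (r : ℂ) ^ l.length else 0) * H β) := by
    rw [PiLp.inner_apply]
    refine Finset.sum_congr rfl fun γ _ => ?_
    rw [← Finset.mul_sum]
    simp [vec, Matrix.mulVec, dotProduct, Mt, mul_comm]
  rw [h0, Finset.sum_comm]
  rw [Finset.sum_coe_sort (W n M) (fun β => ∑ γ : W n M, (starRingEnd ℂ) (H γ) *
        ((if (γ : List (Fin n)) = l ++ β then (r : ℂ) ^ l.length else 0) * H β))]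
  have h3 : ∀ β, (∑ γ : W n M, (starRingEnd ℂ) (H γ) *
        ((if (γ : List (Fin n)) = l ++ β then (r : ℂ) ^ l.length else 0) * H β))
        = if l ++ β ∈ W n M then (r : ℂ) ^ l.length * ((starRingEnd ℂ) (H (l ++ β)) * H β) else 0 := by
    intro β
    rw [Finset.sum_coe_sort (W n M) (fun γ => (starRingEnd ℂ) (H γ) *
        ((if γ = l ++ β then (r : ℂ) ^ l.length else 0) * H β))]
    simp only [ite_mul, zero_mul, mul_ite, mul_zero, Finset.sum_ite_eq']
    split_ifs
    · ring
    · rfl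
  simp_rw [h3]
  rw [← Finset.sum_filter, Finset.mul_sum]
  refine Finset.sum_congr ?_ fun _ _ => rfl
  ext β
  simp [mem_W]
  omega

lemma inner_hol (a : Word n → ℂ) (M : ℕ) (r : ℝ) (H : List (Fin n) → ℂ) :
    inner ℂ (vec M H) (holOp a (Xf M r) (vec M H)) =
      ∑ α ∈ W n M, ∑ β ∈ W n M, L a α β *
        ((r : ℂ) ^ (α.length - β.length) * ((starRingEnd ℂ) (H α) * H β)) := by
  have hz : ∀ k ∉ Finset.range M, truncSum a (Xf (n := n) M r) k = 0 := by
    intro k hk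
    unfold truncSum
    refine Finset.sum_eq_zero fun f _ => ?_
    have : wordProd (Xf M r) (word f) = 0 := by
      unfold wordProd
      rw [prod_Xf]
      have : Mt M r (FreeMonoid.toList (word f)) = 0 := by
        ext γ β
        have hl := mem_W.1 γ.2
        have : ¬ (γ : List (Fin n)) = FreeMonoid.toList (word f) ++ (β : List (Fin n)) := by
          intro e
          rw [e] at hl
          simp [word] at hl hk
          omega
        simp [Mt, this]
      rw [this, map_zero]
    rw [this, smul_zero]
  unfold holOp
  rw [tsum_eq_sum hz, L_sum, _root_.sum_apply, inner_sum]
  refine Finset.sum_congr rfl fun k _ => ?_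
  unfold truncSum
  rw [_root_.sum_apply, inner_sum]
  refine Finset.sum_congr rfl fun f _ => ?_
  rw [_root_.smul_apply, inner_smul_right]
  unfold wordProd
  rw [prod_Xf, inner_Mt]
  simp [word, Finset.mul_sum]

lemma fwd (a : Word n → ℂ)
    (hp : ∀ (K : Type) [NormedAddCommGroup K] [InnerProductSpace ℂ K] [CompleteSpace K]
      (X : Fin n → K →L[ℂ] K), inBall 1 X →
        (holOp a X + adjoint (holOp a X)).IsPositive) (M : ℕ) (H : List (Fin n) → ℂ) :
    0 ≤ ∑ α ∈ W n M, ∑ β ∈ W n M, (starRingEnd ℂ) (H α) *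
      (L a α β + (starRingEnd ℂ) (L a β α)) * H β := by
  set S : ℝ → ℂ := fun r => ∑ α ∈ W n M, ∑ β ∈ W n M, L a α β *
        ((r : ℂ) ^ (α.length - β.length) * ((starRingEnd ℂ) (H α) * H β)) with hS
  have hpos : ∀ r : ℝ, 0 ≤ r → r < 1 → 0 ≤ S r + (starRingEnd ℂ) (S r) := by
    intro r h0 h1
    have := (hp _ (Xf M r) (Xf_ball M r h0 h1)).inner_nonneg_right (vec M H)
    rw [_root_.add_apply, inner_add_right, ContinuousLinearMap.adjoint_inner_right,
      ← inner_conj_symm (holOp a (Xf M r) (vec M H)), inner_hol] at this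
    exact this
  have hcont : Continuous fun r => S r + (starRingEnd ℂ) (S r) := by
    have : Continuous S := by
      rw [hS]
      fun_prop
    exact this.add (Complex.continuous_conj.comp this)
  have hlim : 0 ≤ S 1 + (starRingEnd ℂ) (S 1) := by
    have ht : Tendsto (fun r => S r + (starRingEnd ℂ) (S r)) (nhdsWithin 1 (Set.Iio 1))
      (nhds (S 1 + (starRingEnd ℂ) (S 1))) := hcont.continuousAt.tendsto.mono_left nhdsWithin_le_nhds
    refine ge_of_tendsto ht ?_
    filter_upwards [Ioo_mem_nhdsLT (show (0:ℝ) < 1 by norm_num)] with r hr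
    exact hpos r hr.1.le hr.2
  refine hlim.trans_eq ?_
  have h2 : (starRingEnd ℂ) (S 1) = ∑ α ∈ W n M, ∑ β ∈ W n M, (starRingEnd ℂ) (L a β α) *
        ((starRingEnd ℂ) (H α) * H β) := by
    rw [Finset.sum_comm]
    simp [hS, mul_comm]
  rw [h2]
  simp only [hS, ← Finset.sum_add_distrib]
  refine Finset.sum_congr rfl fun α _ => Finset.sum_congr rfl fun β _ => ?_
  simp
  ring

end fwd

section bwd
variable {n : ℕ} {K : Type} [NormedAddCommGroup K] [InnerProductSpace ℂ K] [CompleteSpace K]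

def Y (X : Fin n → K →L[ℂ] K) (l : List (Fin n)) : K →L[ℂ] K := (l.map X).prod

lemma Y_append (X : Fin n → K →L[ℂ] K) (l m : List (Fin n)) : Y X (l ++ m) = Y X l * Y X m := by
  simp [Y]

def Q (X : Fin n → K →L[ℂ] K) : K →L[ℂ] K := ∑ i, X i * adjoint (X i)

def Ph (X : Fin n → K →L[ℂ] K) (k : ℕ) : K →L[ℂ] K :=
  ∑ f : Fin k → Fin n, Y X (List.ofFn f) * adjoint (Y X (List.ofFn f))

lemma Ph_zero (X : Fin n → K →L[ℂ] K) : Ph X 0 = 1 := by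
  have : adjoint (1 : K →L[ℂ] K) = 1 := star_one _
  simp [Ph, Y, this]

lemma Ph_succ (X : Fin n → K →L[ℂ] K) (k : ℕ) :
    Ph X (k+1) = ∑ f : Fin k → Fin n, Y X (List.ofFn f) * Q X * adjoint (Y X (List.ofFn f)) := by
  unfold Ph
  rw [← (Fin.snocEquiv (fun _ : Fin (k+1) => Fin n)).sum_comp, Fintype.sum_prod_type_right]
  refine Finset.sum_congr rfl fun f _ => ?_
  rw [Q, Finset.mul_sum, Finset.sum_mul]
  refine Finset.sum_congr rfl fun i _ => ?_
  have : List.ofFn ((Fin.snocEquiv (fun _ : Fin (k+1) => Fin n)) (i, f)) = List.ofFn f ++ [i] := by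
    rw [List.ofFn_succ']
    simp [Fin.snocEquiv]
  rw [this, Y_append]
  have h1 : Y X [i] = X i := by simp [Y]
  have h2 : adjoint (Y X (List.ofFn f) * X i) = adjoint (X i) * adjoint (Y X (List.ofFn f)) :=
    star_mul _ _
  rw [h1, h2]
  simp only [mul_assoc]

lemma G_eq (X : Fin n → K →L[ℂ] K) (m : ℕ) :
    ∑ β ∈ W n m, Y X β * (1 - Q X) * adjoint (Y X β) = 1 - Ph X m := by
  induction m with
  | zero => rw [sum_W, Ph_zero]; simp
  | succ m ih =>
    rw [sum_W_succ, ih, Ph_succ]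
    simp only [mul_sub, sub_mul, Finset.sum_sub_distrib, mul_one]
    rw [← Ph]
    abel

lemma inner_Ph (X : Fin n → K →L[ℂ] K) (k : ℕ) (x : K) :
    inner ℂ x (Ph X k x) = ((∑ f : Fin k → Fin n, ‖adjoint (Y X (List.ofFn f)) x‖ ^ 2 : ℝ) : ℂ) := by
  unfold Ph
  rw [_root_.sum_apply, inner_sum]
  push_cast
  refine Finset.sum_congr rfl fun f _ => ?_
  change inner ℂ x (Y X (List.ofFn f) (adjoint (Y X (List.ofFn f)) x)) = _
  rw [← ContinuousLinearMap.adjoint_inner_left, inner_self_eq_norm_sq_to_K]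
  rfl

lemma p_le (X : Fin n → K →L[ℂ] K) (k : ℕ) (x : K) :
    ∑ f : Fin k → Fin n, ‖adjoint (Y X (List.ofFn f)) x‖ ^ 2 ≤ ‖Q X‖ ^ k * ‖x‖ ^ 2 := by
  induction k with
  | zero =>
    have h := inner_Ph X 0 x
    rw [Ph_zero, one_apply_eq_self, inner_self_eq_norm_sq_to_K] at h
    have h' : ‖x‖ ^ 2 = ∑ f : Fin 0 → Fin n, ‖adjoint (Y X (List.ofFn f)) x‖ ^ 2 := by
      exact Complex.ofReal_injective (by rw [← h]; push_cast; rfl)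
    rw [← h']
    simp
  | succ k ih =>
    have h := inner_Ph X (k+1) x
    have h2 : ∑ f : Fin (k+1) → Fin n, ‖adjoint (Y X (List.ofFn f)) x‖ ^ 2
        = (inner ℂ x (Ph X (k+1) x) : ℂ).re := by
      rw [h, Complex.ofReal_re]
    rw [h2, Ph_succ, _root_.sum_apply, inner_sum, Complex.re_sum]
    calc _ ≤ ∑ f : Fin k → Fin n, ‖Q X‖ * ‖adjoint (Y X (List.ofFn f)) x‖ ^ 2 := by
          refine Finset.sum_le_sum fun f _ => ?_
          change (inner ℂ x (Y X (List.ofFn f) (Q X (adjoint (Y X (List.ofFn f)) x))) : ℂ).re ≤ _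
          rw [← ContinuousLinearMap.adjoint_inner_left]
          set z := adjoint (Y X (List.ofFn f)) x
          calc (inner ℂ z (Q X z) : ℂ).re ≤ ‖(inner ℂ z (Q X z) : ℂ)‖ := Complex.re_le_norm _
            _ ≤ ‖z‖ * ‖Q X z‖ := norm_inner_le_norm _ _
            _ ≤ ‖z‖ * (‖Q X‖ * ‖z‖) := by gcongr; exact (Q X).le_opNorm z
            _ = _ := by ring
      _ = ‖Q X‖ * ∑ f : Fin k → Fin n, ‖adjoint (Y X (List.ofFn f)) x‖ ^ 2 := by
          rw [Finset.mul_sum]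
      _ ≤ ‖Q X‖ * (‖Q X‖ ^ k * ‖x‖ ^ 2) := by gcongr
      _ = _ := by ring

lemma row_le (X : Fin n → K →L[ℂ] K) (k : ℕ) (u : (Fin k → Fin n) → K) :
    ‖∑ f : Fin k → Fin n, Y X (List.ofFn f) (u f)‖ ≤
      √(‖Q X‖ ^ k) * √(∑ f, ‖u f‖ ^ 2) := by
  set z := ∑ f : Fin k → Fin n, Y X (List.ofFn f) (u f) with hz
  have h1 : ‖z‖ * ‖z‖ ≤ (√(‖Q X‖ ^ k) * √(∑ f, ‖u f‖ ^ 2)) * ‖z‖ := by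
    calc ‖z‖ * ‖z‖ = (inner ℂ z z : ℂ).re := by
          rw [← inner_self_eq_norm_mul_norm (𝕜 := ℂ)]; rfl
      _ = ∑ f : Fin k → Fin n, (inner ℂ (adjoint (Y X (List.ofFn f)) z) (u f) : ℂ).re := by
          conv_lhs => rw [show (inner ℂ z z : ℂ) = inner ℂ z (∑ f : Fin k → Fin n, Y X (List.ofFn f) (u f)) from rfl, inner_sum, Complex.re_sum]
          simp_rw [ContinuousLinearMap.adjoint_inner_left]
      _ ≤ ∑ f : Fin k → Fin n, ‖adjoint (Y X (List.ofFn f)) z‖ * ‖u f‖ := by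
          refine Finset.sum_le_sum fun f _ => ?_
          exact (Complex.re_le_norm _).trans (norm_inner_le_norm _ _)
      _ ≤ √(∑ f : Fin k → Fin n, ‖adjoint (Y X (List.ofFn f)) z‖ ^ 2) * √(∑ f, ‖u f‖ ^ 2) :=
          Real.sum_mul_le_sqrt_mul_sqrt _ _ _
      _ ≤ √(‖Q X‖ ^ k * ‖z‖ ^ 2) * √(∑ f, ‖u f‖ ^ 2) := by
          gcongr
          exact p_le X k z
      _ = _ := by
          rw [Real.sqrt_mul (by positivity), Real.sqrt_sq (norm_nonneg _)]; ring
  rcases eq_or_lt_of_le (norm_nonneg z) with h | h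
  · rw [← h]; positivity
  · exact le_of_mul_le_mul_right h1 h

lemma norm_Ph (X : Fin n → K →L[ℂ] K) (k : ℕ) (x : K) : ‖Ph X k x‖ ≤ ‖Q X‖ ^ k * ‖x‖ := by
  have h := row_le X k (fun f => adjoint (Y X (List.ofFn f)) x)
  have e : ∑ f : Fin k → Fin n, Y X (List.ofFn f) (adjoint (Y X (List.ofFn f)) x) = Ph X k x := by
    simp [Ph, _root_.sum_apply]
  rw [e] at h
  refine h.trans ?_
  calc _ ≤ √(‖Q X‖ ^ k) * √(‖Q X‖ ^ k * ‖x‖ ^ 2) := by gcongr; exact p_le X k x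
    _ = _ := by
      rw [Real.sqrt_mul (by positivity), Real.sqrt_sq (norm_nonneg _), ← mul_assoc,
        Real.mul_self_sqrt (by positivity)]

lemma norm_trunc (a : Word n → ℂ) (X : Fin n → K →L[ℂ] K) (k : ℕ) :
    ‖truncSum a X k‖ ≤ √(‖Q X‖ ^ k) * √(∑ f : Fin k → Fin n, ‖a (word f)‖ ^ 2) := by
  refine ContinuousLinearMap.opNorm_le_bound _ (by positivity) fun x => ?_
  have h := row_le X k (fun f => a (word f) • x)
  have e : ∑ f : Fin k → Fin n, Y X (List.ofFn f) (a (word f) • x) = truncSum a X k x := by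
    simp only [truncSum, _root_.sum_apply, map_smul, _root_.smul_apply]
    rfl
  rw [e] at h
  refine h.trans_eq ?_
  simp_rw [norm_smul, mul_pow]
  rw [← Finset.sum_mul, Real.sqrt_mul (by positivity), Real.sqrt_sq (norm_nonneg _), mul_assoc]

lemma rad_bound (a : Word n → ℂ) (ha : radCond 1 a) (ρ : ℝ) (hρ : 1 < ρ) :
    ∀ᶠ k : ℕ in atTop, √(∑ f : Fin k → Fin n, ‖a (word f)‖ ^ 2) ≤ ρ ^ k := by
  unfold radCond at ha
  have h1 : ENNReal.ofReal (1/1) < ENNReal.ofReal ρ := by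
    rw [ENNReal.ofReal_lt_ofReal_iff (by linarith)]; simpa using hρ
  have h2 := Filter.eventually_lt_of_limsup_lt (lt_of_le_of_lt ha h1)
  filter_upwards [h2, eventually_gt_atTop 0] with k hk hk0
  have hk0' : (0:ℝ) < k := by exact_mod_cast hk0
  have h3 := ENNReal.rpow_le_rpow hk.le (show (0:ℝ) ≤ 2 * k by positivity)
  rw [← ENNReal.rpow_mul, one_div, inv_mul_cancel₀ (by positivity), ENNReal.rpow_one] at h3
  have h4 : (∑ f : Fin k → Fin n, (‖a (word f)‖₊ : ℝ≥0∞) ^ 2)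
      = ENNReal.ofReal (∑ f : Fin k → Fin n, ‖a (word f)‖ ^ 2) := by
    rw [ENNReal.ofReal_sum_of_nonneg (fun _ _ => by positivity)]
    refine Finset.sum_congr rfl fun f _ => ?_
    rw [ENNReal.ofReal_pow (norm_nonneg _), ofReal_norm]
    rfl
  have h5 : ENNReal.ofReal ρ ^ (2 * (k:ℝ)) = ENNReal.ofReal ((ρ ^ k) ^ 2) := by
    rw [← pow_mul, ENNReal.ofReal_pow (by linarith), ← ENNReal.rpow_natCast]
    congr 1
    push_cast
    ring
  rw [h4, h5, ENNReal.ofReal_le_ofReal_iff (by positivity)] at h3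
  exact Real.sqrt_le_iff.2 ⟨by positivity, h3⟩

lemma summable_trunc (a : Word n → ℂ) (ha : radCond 1 a) (X : Fin n → K →L[ℂ] K)
    (hX : ‖Q X‖ < 1) : Summable fun k => ‖truncSum a X k‖ := by
  set t := √‖Q X‖ with ht
  have ht0 : 0 ≤ t := Real.sqrt_nonneg _
  have ht1 : t < 1 := by rw [ht, Real.sqrt_lt' one_pos]; simpa using hX
  have hρ : 1 < 2 / (1 + t) := by rw [lt_div_iff₀ (by linarith)]; linarith
  have hb := rad_bound a ha _ hρ
  have hlt : t * (2 / (1 + t)) < 1 := by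
    rw [← mul_div_assoc, div_lt_one (by linarith)]; linarith
  refine Summable.of_norm_bounded_eventually_nat
    (summable_geometric_of_lt_one (by positivity) hlt) ?_
  filter_upwards [hb] with k hk
  rw [norm_norm, mul_pow]
  refine (norm_trunc a X k).trans ?_
  have : √(‖Q X‖ ^ k) = t ^ k := by
    rw [show ‖Q X‖ ^ k = (t ^ k) ^ 2 by rw [← pow_mul, mul_comm, pow_mul, ht, Real.sq_sqrt (norm_nonneg _)],
      Real.sqrt_sq (by positivity)]
  rw [this]
  gcongr

lemma T_pos (a : Word n → ℂ) (M : ℕ)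
    (hp : ∀ (H : List (Fin n) → ℂ), 0 ≤ ∑ α ∈ W n M, ∑ β ∈ W n M, (starRingEnd ℂ) (H α) *
      (L a α β + (starRingEnd ℂ) (L a β α)) * H β)
    (D : K →L[ℂ] K) (hD : D.IsPositive) (V : List (Fin n) → K) :
    0 ≤ ∑ α ∈ W n M, ∑ β ∈ W n M, (L a α β + (starRingEnd ℂ) (L a β α)) *
      (inner ℂ (V α) (D (V β)) : ℂ) := by
  classical
  set N : Matrix (W n M) (W n M) ℂ := Matrix.of fun α β =>
    L a α β + (starRingEnd ℂ) (L a β α) with hN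
  have hps : N.PosSemidef := by
    refine Matrix.PosSemidef.of_dotProduct_mulVec_nonneg ?_ ?_
    · ext α β
      simp [hN, add_comm]
    · intro x
      have := hp (fun l => if h : l ∈ W n M then x ⟨l, h⟩ else 0)
      rw [← Finset.sum_coe_sort] at this
      simp_rw [← Finset.sum_coe_sort (W n M)] at this
      refine this.trans_eq ?_
      simp [dotProduct, Matrix.mulVec, hN, Finset.mul_sum, mul_assoc]
  obtain ⟨m, v, hv⟩ := Matrix.posSemidef_iff_eq_sum_vecMulVec.1 hps
  rw [← Finset.sum_coe_sort]
  simp_rw [← Finset.sum_coe_sort (W n M)]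
  have key : ∀ α β : W n M, L a α β + (starRingEnd ℂ) (L a β α)
      = ∑ i, v i α * (starRingEnd ℂ) (v i β) := by
    intro α β
    have := congrFun (congrFun hv α) β
    rw [Matrix.sum_apply] at this
    simpa [hN, Matrix.vecMulVec_apply] using this
  have : ∑ α : W n M, ∑ β : W n M, (L a α β + (starRingEnd ℂ) (L a β α)) *
      (inner ℂ (V α) (D (V β)) : ℂ) =
      ∑ i, inner ℂ (∑ α : W n M, (starRingEnd ℂ) (v i α) • V α)
        (D (∑ β : W n M, (starRingEnd ℂ) (v i β) • V β)) := by
    simp_rw [key, map_sum, sum_inner, inner_sum, map_smul, inner_smul_left, inner_smul_right,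
      Finset.sum_mul]
    conv_lhs => enter [2, α]; rw [Finset.sum_comm]
    rw [Finset.sum_comm]
    refine Finset.sum_congr rfl fun i _ => Finset.sum_congr rfl fun α _ =>
      Finset.sum_congr rfl fun β _ => ?_
    simp
    ring
  rw [this]
  exact Finset.sum_nonneg fun i _ => hD.inner_nonneg_right _

lemma S_eq (a : Word n → ℂ) (X : Fin n → K →L[ℂ] K) (x : K) (M : ℕ) :
    ∑ α ∈ W n M, ∑ β ∈ W n M, L a α β *
      (inner ℂ (adjoint (Y X α) x) ((1 - Q X) (adjoint (Y X β) x)) : ℂ)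
    = ∑ k ∈ Finset.range M, inner ℂ x (truncSum a X k (x - Ph X (M - k) x)) := by
  rw [L_sum]
  refine Finset.sum_congr rfl fun k _ => ?_
  unfold truncSum
  rw [_root_.sum_apply, inner_sum]
  refine Finset.sum_congr rfl fun f _ => ?_
  rw [_root_.smul_apply, inner_smul_right]
  congr 1
  have hG := congrArg (fun T : K →L[ℂ] K => T x) (G_eq X (M - k))
  simp only [_root_.sum_apply, _root_.sub_apply, one_apply_eq_self] at hG
  rw [← hG, map_sum, inner_sum]
  refine Finset.sum_congr rfl fun β _ => ?_
  have h2 : wordProd X (word f) = Y X (List.ofFn f) := rfl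
  rw [Y_append, h2, ContinuousLinearMap.adjoint_inner_left]
  rfl

lemma D_pos (X : Fin n → K →L[ℂ] K) (hX : ‖Q X‖ < 1) : (1 - Q X).IsPositive := by
  have hQ : (Q X).IsPositive := by
    unfold Q
    exact ContinuousLinearMap.isPositive_sum _ fun i _ =>
      ContinuousLinearMap.isPositive_self_comp_adjoint (X i)
  rw [ContinuousLinearMap.isPositive_def']
  refine ⟨(IsSelfAdjoint.one _).sub hQ.isSelfAdjoint, fun x => ?_⟩
  rw [ContinuousLinearMap.reApplyInnerSelf_apply, _root_.sub_apply, inner_sub_left, map_sub,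
    one_apply_eq_self, inner_self_eq_norm_mul_norm]
  have : RCLike.re (inner ℂ (Q X x) x) ≤ ‖x‖ * ‖x‖ := by
    calc RCLike.re (inner ℂ (Q X x) x) ≤ ‖(inner ℂ (Q X x) x : ℂ)‖ := RCLike.re_le_norm _
      _ ≤ ‖Q X x‖ * ‖x‖ := norm_inner_le_norm _ _
      _ ≤ (‖Q X‖ * ‖x‖) * ‖x‖ := by gcongr; exact (Q X).le_opNorm x
      _ ≤ (1 * ‖x‖) * ‖x‖ := by gcongr
      _ = _ := by ring
  linarith

lemma S_lim (a : Word n → ℂ) (ha : radCond 1 a) (X : Fin n → K →L[ℂ] K)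
    (hX : ‖Q X‖ < 1) (x : K) :
    Tendsto (fun M => ∑ k ∈ Finset.range M, (inner ℂ x (truncSum a X k (x - Ph X (M - k) x)) : ℂ))
      atTop (nhds (inner ℂ x (holOp a X x))) := by
  have hs := summable_trunc a ha X hX
  have h1 : inner ℂ x (holOp a X x) = ∑' k, (inner ℂ x (truncSum a X k x) : ℂ) := by
    unfold holOp
    have hh := hs.of_norm.hasSum
    have h2 := (ContinuousLinearMap.apply ℂ K x).hasSum hh
    have h3 := (innerSL ℂ x).hasSum h2
    exact h3.tsum_eq.symm
  rw [h1]
  have h2 : ∀ M, ∑ k ∈ Finset.range M, (inner ℂ x (truncSum a X k (x - Ph X (M - k) x)) : ℂ)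
      = ∑' k, if k < M then (inner ℂ x (truncSum a X k (x - Ph X (M - k) x)) : ℂ) else 0 := by
    intro M
    rw [tsum_eq_sum (s := Finset.range M)]
    · exact Finset.sum_congr rfl fun k hk => by rw [if_pos (Finset.mem_range.1 hk)]
    · intro k hk
      rw [if_neg (by simpa using hk)]
  simp_rw [h2]
  refine tendsto_tsum_of_dominated_convergence (bound := fun k => ‖x‖ * (‖truncSum a X k‖ * (2 * ‖x‖)))
    ((hs.mul_right _).mul_left _) ?_ ?_
  · intro k
    have hP : Tendsto (fun M => Ph X (M - k) x) atTop (nhds 0) := by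
      have h0 : Tendsto (fun m => Ph X m x) atTop (nhds 0) := by
        refine squeeze_zero_norm (norm_Ph X · x) ?_
        simpa using (tendsto_pow_atTop_nhds_zero_of_lt_one (norm_nonneg _) hX).mul_const ‖x‖
      exact h0.comp (tendsto_sub_atTop_nat k)
    have hc : Tendsto (fun M => (inner ℂ x (truncSum a X k (x - Ph X (M - k) x)) : ℂ)) atTop
        (nhds (inner ℂ x (truncSum a X k x))) := by
      have hcont : Continuous fun y : K => (inner ℂ x (truncSum a X k (x - y)) : ℂ) := by fun_prop
      have := (hcont.tendsto 0).comp hP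
      rw [sub_zero] at this
      exact this
    refine hc.congr' ?_
    filter_upwards [eventually_gt_atTop k] with M hM
    rw [if_pos hM]
  · refine Eventually.of_forall fun M k => ?_
    split_ifs
    · refine (norm_inner_le_norm _ _).trans ?_
      gcongr
      refine (ContinuousLinearMap.le_opNorm _ _).trans ?_
      gcongr
      refine (norm_sub_le _ _).trans ?_
      have : ‖Ph X (M - k) x‖ ≤ 1 * ‖x‖ := (norm_Ph X _ x).trans (by
        gcongr; exact pow_le_one₀ (norm_nonneg _) hX.le)
      linarith
    · rw [norm_zero]; positivity

lemma bwd (a : Word n → ℂ) (ha : radCond 1 a)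
    (hp : ∀ (M : ℕ) (H : List (Fin n) → ℂ), 0 ≤ ∑ α ∈ W n M, ∑ β ∈ W n M, (starRingEnd ℂ) (H α) *
      (L a α β + (starRingEnd ℂ) (L a β α)) * H β)
    (X : Fin n → K →L[ℂ] K) (hX : inBall 1 X) :
    (holOp a X + adjoint (holOp a X)).IsPositive := by
  have hX' : ‖Q X‖ < 1 := by simpa [inBall, Q] using hX
  have hD := D_pos X hX'
  rw [ContinuousLinearMap.isPositive_iff']
  refine ⟨IsSelfAdjoint.add_star_self _, fun x => ?_⟩
  have e : inner ℂ ((holOp a X + adjoint (holOp a X)) x) x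
      = inner ℂ x (holOp a X x) + (starRingEnd ℂ) (inner ℂ x (holOp a X x)) := by
    rw [_root_.add_apply, inner_add_left, ContinuousLinearMap.adjoint_inner_left, inner_conj_symm,
      add_comm]
  rw [e]
  have hl := S_lim a ha X hX' x
  have hl2 := hl.add ((Complex.continuous_conj.tendsto _).comp hl)
  refine ge_of_tendsto' hl2 fun M => ?_
  have hT := T_pos a M (hp M) _ hD (fun l => adjoint (Y X l) x)
  refine hT.trans_eq ?_
  simp only [Function.comp_apply]
  rw [← S_eq]
  simp only [add_mul, Finset.sum_add_distrib]
  congr 1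
  rw [Finset.sum_comm, map_sum]
  refine Finset.sum_congr rfl fun α _ => ?_
  rw [map_sum]
  refine Finset.sum_congr rfl fun β _ => ?_
  rw [map_mul, inner_conj_symm, hD.inner_left_eq_inner_right]

end bwd

end Cara

/-- A free holomorphic function has positive real part on the unit ball
iff the associated multi-Toeplitz kernel `K_f` is positive semidefinite. -/
theorem stmt_17 (n : ℕ) (hn : 1 ≤ n)
    (a : Word n → ℂ) (ha : radCond 1 a) :
    (∀ (K : Type) [NormedAddCommGroup K] [InnerProductSpace ℂ K] [CompleteSpace K]
      (X : Fin n → K →L[ℂ] K), inBall 1 X →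
        (holOp a X + adjoint (holOp a X)).IsPositive) ↔
    (∀ (s : Finset (Word n)) (h : Word n → ℂ),
      0 ≤ ∑ α ∈ s, ∑ β ∈ s, (starRingEnd ℂ) (h α) * caraKer a α β * h β) := by
  exact ⟨fun h => Cara.cond_of_W a (Cara.fwd a h),
    fun h K _ _ _ X hX => Cara.bwd a ha (Cara.cond_W a h) X hX⟩

end
end
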